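/- There exist constants C₀ and C such that the following holds for the two-block stochastic block model SBM(n,a,b) with a > b ≥ C₀ and d := a+b. Let A₀ be the adjacency matrix, Ā₀ = E[A₀], E₀ = A₀ − Ā₀, and let E be obtained from E₀ by zeroing out the rows and columns corresponding to vertices of degree greater than 20d. Then with probability 1 − o(1), the operator norm satisfies ‖E‖ ≤ C·√d. -/

import Mathlib

open MeasureTheory Filter Finset

/-- The Bernoulli measure on `Bool` with success probability `p` (clamped to `[0,1]`). -/
noncomputable def bern (p : ℝ) : Measure Bool :=
  (PMF.bernoulli (min (Real.toNNReal p) 1) (min_le_right _ _)).toMeasure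

instance (p : ℝ) : IsProbabilityMeasure (bern p) := by
  unfold bern; infer_instance

/-- Index set for the unordered pairs of distinct vertices of `Fin N`. -/
abbrev EdgeIdx (N : ℕ) := {e : Fin N × Fin N // e.1 < e.2}

/-- A configuration of edges: which unordered pairs form an edge. -/
abbrev Config (N : ℕ) := EdgeIdx N → Bool

/-- A colored configuration: for every pair, (edge present, edge Red). For the censor
block model the second component is instead the noise bit of the pair. -/
abbrev CConfig (N : ℕ) := EdgeIdx N → Bool × Bool

/-- Adjacency relation of the graph determined by a configuration. -/
def adjOf {N : ℕ} (ω : Config N) (i j : Fin N) : Bool :=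
  if h : i < j then ω ⟨(i, j), h⟩ else if h : j < i then ω ⟨(j, i), h⟩ else false

/-- Degree of a vertex in the graph determined by a configuration. -/
def degOf {N : ℕ} (ω : Config N) (v : Fin N) : ℕ :=
  (univ.filter fun j => adjOf ω v j).card

/-- The two-block stochastic block model `SBM(n,a,b)` on `2*n` vertices: within-block
pairs are edges with probability `a/n`, cross-block pairs with probability `b/n`,
independently. -/
noncomputable def sbm2 (n : ℕ) (a b : ℝ) : Measure (Config (2 * n)) :=
  Measure.pi fun e =>
    bern (if ((e.1.1 : ℕ) < n ↔ (e.1.2 : ℕ) < n) then a / n else b / n)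

/-- The first block `V₁` (the first `n` vertices). -/
def block1 (n : ℕ) : Finset (Fin (2 * n)) := univ.filter fun i => (i : ℕ) < n

/-- The second block `V₂` (the last `n` vertices). -/
def block2 (n : ℕ) : Finset (Fin (2 * n)) := univ.filter fun i => ¬ (i : ℕ) < n

/-- `(V₁', V₂')` is `γ`-correct: `|Vᵢ ∩ Vᵢ'| ≥ (1-γ)n` for `i = 1,2`. -/
def correct2 (n : ℕ) (γ : ℝ) (P : Finset (Fin (2 * n)) × Finset (Fin (2 * n))) : Prop :=
  (1 - γ) * (n : ℝ) ≤ ((block1 n ∩ P.1).card : ℝ) ∧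
  (1 - γ) * (n : ℝ) ≤ ((block2 n ∩ P.2).card : ℝ)

/-- A pair of disjoint subsets partitioning the vertex set. -/
def isPartition2 {N : ℕ} (P : Finset (Fin N) × Finset (Fin N)) : Prop :=
  Disjoint P.1 P.2 ∧ P.1 ∪ P.2 = univ

/-- Expected adjacency matrix of `SBM(n,a,b)`. -/
noncomputable def expAdj (n : ℕ) (a b : ℝ) : Matrix (Fin (2 * n)) (Fin (2 * n)) ℝ :=
  fun i j => if i = j then 0 else if ((i : ℕ) < n ↔ (j : ℕ) < n) then a / n else b / n

/-- Adjacency matrix (over `ℝ`) of the graph determined by a configuration. -/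
noncomputable def adjMat {N : ℕ} (ω : Config N) : Matrix (Fin N) (Fin N) ℝ :=
  fun i j => if adjOf ω i j then 1 else 0

/-- Zero out all rows and columns corresponding to vertices of degree `> 20 d`. -/
noncomputable def zeroOutHighDeg {N : ℕ} (d : ℝ) (ω : Config N)
    (M : Matrix (Fin N) (Fin N) ℝ) : Matrix (Fin N) (Fin N) ℝ :=
  fun i j => if 20 * d < (degOf ω i : ℝ) ∨ 20 * d < (degOf ω j : ℝ) then 0 else M i j

/-- The spectral (ℓ² operator) norm of a real square matrix. -/
noncomputable def opNorm {N : ℕ} (M : Matrix (Fin N) (Fin N) ℝ) : ℝ :=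
  ‖LinearMap.toContinuousLinearMap (Matrix.toEuclideanLin M)‖

/-- The orthogonal projection onto a subspace, as an endomorphism. -/
noncomputable def projCLM {N : ℕ} (W : Submodule ℝ (EuclideanSpace ℝ (Fin N))) :
    EuclideanSpace ℝ (Fin N) →L[ℝ] EuclideanSpace ℝ (Fin N) :=
  W.subtypeL.comp W.orthogonalProjection

/-- `sin ∠(W₁, W₂) := ‖P_{W₁} - P_{W₂}‖`. -/
noncomputable def sinAngle {N : ℕ} (W₁ W₂ : Submodule ℝ (EuclideanSpace ℝ (Fin N))) : ℝ :=
  ‖projCLM W₁ - projCLM W₂‖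

/-- Build a vector of `EuclideanSpace ℝ (Fin N)` from its coordinates. -/
noncomputable def mkVec {N : ℕ} (f : Fin N → ℝ) : EuclideanSpace ℝ (Fin N) :=
  (EuclideanSpace.equiv (Fin N) ℝ).symm f

/-- `W` is the eigenspace corresponding to the top two eigenvalues of the symmetric
matrix `M`: it is spanned by two orthonormal eigenvectors whose eigenvalues dominate
every eigenvalue attained on `Wᗮ`. -/
def IsTopTwoSpace {N : ℕ} (M : Matrix (Fin N) (Fin N) ℝ)
    (W : Submodule ℝ (EuclideanSpace ℝ (Fin N))) : Prop :=
  ∃ (u₁ u₂ : EuclideanSpace ℝ (Fin N)) (μ₁ μ₂ : ℝ),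
    (inner ℝ u₁ u₂ : ℝ) = 0 ∧ ‖u₁‖ = 1 ∧ ‖u₂‖ = 1 ∧
    W = Submodule.span ℝ {u₁, u₂} ∧
    Matrix.toEuclideanLin M u₁ = μ₁ • u₁ ∧
    Matrix.toEuclideanLin M u₂ = μ₂ • u₂ ∧
    ∀ (μ : ℝ) (v : EuclideanSpace ℝ (Fin N)), v ≠ 0 → v ∈ Wᗮ →
      Matrix.toEuclideanLin M v = μ • v → μ ≤ min μ₁ μ₂

/-- `P` is a possible output of the **Spectral Partition** algorithm run on the
configuration `ω` with degree parameter `d`. -/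
def IsSpectralOutput (n : ℕ) (ω : Config (2 * n)) (d : ℝ)
    (P : Finset (Fin (2 * n)) × Finset (Fin (2 * n))) : Prop :=
  ∃ (W : Submodule ℝ (EuclideanSpace ℝ (Fin (2 * n))))
    (v : EuclideanSpace ℝ (Fin (2 * n))),
    IsTopTwoSpace (zeroOutHighDeg d ω (adjMat ω)) W ∧
    v ∈ W ∧ ‖v‖ = 1 ∧ (inner ℝ (projCLM W (mkVec fun _ => 1)) v : ℝ) = 0 ∧
    P.1.card = n ∧ P.2 = P.1ᶜ ∧ ∀ i ∈ P.1, ∀ j ∈ P.2, v j ≤ v i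

/-- The two-block SBM together with an independent fair Red/Blue coloring of each edge:
first component = edge present, second component = edge colored Red. -/
noncomputable def sbm2c (n : ℕ) (a b : ℝ) : Measure (CConfig (2 * n)) :=
  Measure.pi fun e =>
    (bern (if ((e.1.1 : ℕ) < n ↔ (e.1.2 : ℕ) < n) then a / n else b / n)).prod
      (bern (1 / 2))

/-- The Red subgraph of a colored configuration. -/
def redConf {N : ℕ} (ω : CConfig N) : Config N := fun e => (ω e).1 && (ω e).2

/-- The Blue subgraph of a colored configuration. -/
def blueConf {N : ℕ} (ω : CConfig N) : Config N := fun e => (ω e).1 && !(ω e).2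

/-- Number of Blue neighbors of `u` inside `S`. -/
noncomputable def blueDegIn {N : ℕ} (ω : CConfig N) (S : Finset (Fin N)) (u : Fin N) : ℕ :=
  (S.filter fun v => adjOf (blueConf ω) u v).card

/-- Number of Red neighbors of `u` inside `S`. -/
noncomputable def redDegIn {N : ℕ} (ω : CConfig N) (S : Finset (Fin N)) (u : Fin N) : ℕ :=
  (S.filter fun v => adjOf (redConf ω) u v).card

/-- The **Correction** subroutine with threshold `t`: a vertex of `P.i` is bad if it has
at least `t` Blue neighbors in the other class; bad vertices are moved to the other side. -/
noncomputable def corrected2 {N : ℕ} (t : ℝ) (ω : CConfig N)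
    (P : Finset (Fin N) × Finset (Fin N)) : Finset (Fin N) × Finset (Fin N) :=
  let bad1 := P.1.filter fun u => t ≤ (blueDegIn ω P.2 u : ℝ)
  let bad2 := P.2.filter fun u => t ≤ (blueDegIn ω P.1 u : ℝ)
  ((P.1 \ bad1) ∪ bad2, (P.2 \ bad2) ∪ bad1)

/-- The `k`-block SBM on `k*m` vertices (`k` blocks of size `m`, so `n = k*m` total
vertices and edge probabilities `a/n` within blocks and `b/n` across). -/
noncomputable def sbmK (k m : ℕ) (a b : ℝ) : Measure (Config (k * m)) :=
  Measure.pi fun e =>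
    bern (if (e.1.1 : ℕ) / m = (e.1.2 : ℕ) / m then a / (k * m) else b / (k * m))

/-- The `i`-th block `Vᵢ` (of size `m = n/k`). -/
def blockK (k m : ℕ) (i : Fin k) : Finset (Fin (k * m)) :=
  univ.filter fun v => (v : ℕ) / m = (i : ℕ)

/-- The subset `Z` selected by the splitting coins `s` (its complement is `Y`). -/
def Zset {N : ℕ} (s : Fin N → Bool) : Finset (Fin N) := univ.filter fun v => s v = true

/-- The `k`-block SBM together with a uniformly random split of the vertices. -/
noncomputable def sbmKs (k m : ℕ) (a b : ℝ) :
    Measure ((Fin (k * m) → Bool) × Config (k * m)) :=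
  (Measure.pi fun _ : Fin (k * m) => bern (1 / 2)).prod (sbmK k m a b)

/-- The `k`-block SBM together with a uniformly random split of the vertices and an
independent fair Red/Blue coloring of each edge. -/
noncomputable def sbmKsc (k m : ℕ) (a b : ℝ) :
    Measure ((Fin (k * m) → Bool) × CConfig (k * m)) :=
  (Measure.pi fun _ : Fin (k * m) => bern (1 / 2)).prod
    (Measure.pi fun e : EdgeIdx (k * m) =>
      (bern (if (e.1.1 : ℕ) / m = (e.1.2 : ℕ) / m then a / (k * m) else b / (k * m))).prod
        (bern (1 / 2)))

/-- `U` is a `γ`-correct partition of `Z = (V₁ ∩ Z) ∪ ... ∪ (V_k ∩ Z)`: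
a collection of disjoint subsets of `Z` covering `Z` with
`|(Vᵢ ∩ Z) ∩ Uᵢ| ≥ (1-γ)|Vᵢ ∩ Z|` for every `i`. -/
def correctOnZ (k m : ℕ) (γ : ℝ) (s : Fin (k * m) → Bool)
    (U : Fin k → Finset (Fin (k * m))) : Prop :=
  (∀ i, U i ⊆ Zset s) ∧ (∀ i j, i ≠ j → Disjoint (U i) (U j)) ∧
  (univ.biUnion U = Zset s) ∧
  ∀ i, (1 - γ) * ((blockK k m i ∩ Zset s).card : ℝ) ≤
    (((blockK k m i ∩ Zset s) ∩ U i).card : ℝ)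

/-- Censor block model: for every pair of vertices, an independent pair
(edge present with probability `p`, noise bit with probability `ε`). -/
noncomputable def cbmMeasure (n : ℕ) (p ε : ℝ) : Measure (CConfig (2 * n)) :=
  Measure.pi fun _ => (bern p).prod (bern ε)

/-- The observation `y = B_G x ⊕ z` of the censor block model: for each present edge
`(i,j)` one observes `x_i ⊕ x_j ⊕ z_e` (where `x` is the indicator of the second
block); nothing is observed on absent edges. -/
def cbmObs (n : ℕ) (ω : CConfig (2 * n)) (e : EdgeIdx (2 * n)) : Option Bool :=
  if (ω e).1 then
    some (xor (xor (decide ((e.1.1 : ℕ) < n)) (decide ((e.1.2 : ℕ) < n))) (ω e).2)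
  else none

/-- `e(S,T)`: adjacency-matrix count of edges between `S` and `T` in a simple graph. -/
def eCount {n : ℕ} (G : SimpleGraph (Fin n)) [DecidableRel G.Adj]
    (S T : Finset (Fin n)) : ℝ :=
  ∑ i ∈ S, ∑ j ∈ T, if G.Adj i j then 1 else 0

/-- `e(S,T)` for the graph of a configuration. -/
def eCountC {n : ℕ} (ω : Config n) (S T : Finset (Fin n)) : ℝ :=
  ∑ i ∈ S, ∑ j ∈ T, if adjOf ω i j then 1 else 0

/-- The random symmetric matrix model: independent edges, pair `(i,j)` present with
probability `p i j`. -/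
noncomputable def genMeasure {n : ℕ} (p : Fin n → Fin n → ℝ) : Measure (Config n) :=
  Measure.pi fun e => bern (p e.1.1 e.1.2)

/-- The centered matrix `M` with `M_ij = 1 - p_ij` if the pair is present and
`M_ij = -p_ij` otherwise, and zero diagonal. -/
noncomputable def centeredMat {n : ℕ} (p : Fin n → Fin n → ℝ) (ω : Config n) :
    Matrix (Fin n) (Fin n) ℝ :=
  fun i j => if i = j then 0 else (if adjOf ω i j then 1 else 0) - p i j

/-- Number of positive entries in row `i` of `M`. -/
noncomputable def posRowCount {n : ℕ} (M : Matrix (Fin n) (Fin n) ℝ) (i : Fin n) : ℕ :=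
  (univ.filter fun j => 0 < M i j).card

/-- Zero out the rows and columns indexed by `S`. -/
noncomputable def zeroOutRows {n : ℕ} (S : Finset (Fin n)) (M : Matrix (Fin n) (Fin n) ℝ) :
    Matrix (Fin n) (Fin n) ℝ :=
  fun i j => if i ∈ S ∨ j ∈ S then 0 else M i j

/-- The all-ones direction `v̄₁` (unit vector). -/
noncomputable def vbar1 (n : ℕ) : EuclideanSpace ℝ (Fin (2 * n)) :=
  mkVec fun _ => 1 / Real.sqrt (2 * n)

/-- The block-indicator direction `v̄₂` (unit vector). -/
noncomputable def vbar2 (n : ℕ) : EuclideanSpace ℝ (Fin (2 * n)) :=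
  mkVec fun i =>
    if (i : ℕ) < n then 1 / Real.sqrt (2 * n) else -(1 / Real.sqrt (2 * n))

/-- Summing a matrix with zero diagonal over ordered pairs amounts to summing its
symmetrization over edges. -/
lemma sum_sum_eq_sum_edgeIdx {N : ℕ} (g : Fin N → Fin N → ℝ) (h : ∀ i, g i i = 0) :
    ∑ i, ∑ j, g i j = ∑ e : EdgeIdx N, (g e.1.1 e.1.2 + g e.1.2 e.1.1) := by
  have key : ∀ f : Fin N × Fin N → ℝ,
      ∑ e : EdgeIdx N, f e.1 = ∑ i, ∑ j, if i < j then f (i, j) else 0 := by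
    intro f
    rw [← Finset.sum_subtype (univ.filter fun x : Fin N × Fin N => x.1 < x.2) (by simp) f,
      Finset.sum_filter, Fintype.sum_prod_type]
  rw [Finset.sum_add_distrib, key fun x => g x.1 x.2, key fun x => g x.2 x.1,
    Finset.sum_comm (f := fun i j => if i < j then g j i else 0), ← Finset.sum_add_distrib]
  refine Finset.sum_congr rfl fun i _ => ?_
  rw [← Finset.sum_add_distrib]
  refine Finset.sum_congr rfl fun j _ => ?_
  rcases lt_trichotomy i j with hij | rfl | hij
  · simp [hij, hij.not_gt]
  · simp [h]
  · simp [hij, hij.not_gt]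

lemma sum_edgeIdx_le_sum_sum {N : ℕ} (g : Fin N → Fin N → ℝ) (h : ∀ i j, 0 ≤ g i j) :
    ∑ e : EdgeIdx N, (g e.1.1 e.1.2 + g e.1.2 e.1.1) ≤ ∑ i, ∑ j, g i j := by
  have h2 : ∑ e : EdgeIdx N, (g e.1.1 e.1.2 + g e.1.2 e.1.1) =
      ∑ i, ∑ j, if i = j then 0 else g i j := by
    rw [sum_sum_eq_sum_edgeIdx _ (by simp)]
    refine Finset.sum_congr rfl fun e _ => ?_
    rw [if_neg (ne_of_lt e.2), if_neg (ne_of_gt e.2)]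
  rw [h2]
  refine Finset.sum_le_sum fun i _ => Finset.sum_le_sum fun j _ => ?_
  split_ifs
  exacts [h i j, le_rfl]

/-- The indicator of the presence of an edge. -/
noncomputable def bitVal (b : Bool) : ℝ := if b then 1 else 0

lemma adjMat_edge {N : ℕ} (ω : Config N) (e : EdgeIdx N) :
    adjMat ω e.1.1 e.1.2 = bitVal (ω e) := by
  simp [adjMat, adjOf, bitVal, e.2]

lemma adjMat_symm {N : ℕ} (ω : Config N) (i j : Fin N) : adjMat ω i j = adjMat ω j i := by
  rcases lt_trichotomy i j with hij | rfl | hij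
  · simp [adjMat, adjOf, hij, hij.not_gt]
  · rfl
  · simp [adjMat, adjOf, hij, hij.not_gt]

lemma adjMat_self {N : ℕ} (ω : Config N) (i : Fin N) : adjMat ω i i = 0 := by
  simp [adjMat, adjOf]

lemma adjMat_nonneg {N : ℕ} (ω : Config N) (i j : Fin N) : 0 ≤ adjMat ω i j := by
  unfold adjMat; split_ifs <;> norm_num

lemma sum_adjMat_row {N : ℕ} (ω : Config N) (i : Fin N) :
    ∑ j, adjMat ω i j = degOf ω i := by
  simp [adjMat, degOf]

lemma sum_mul_adjMat {N : ℕ} (ω : Config N) (c : Fin N → Fin N → ℝ) :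
    ∑ i, ∑ j, c i j * adjMat ω i j =
      ∑ e : EdgeIdx N, (c e.1.1 e.1.2 + c e.1.2 e.1.1) * bitVal (ω e) := by
  rw [sum_sum_eq_sum_edgeIdx _ (by simp [adjMat_self])]
  refine Finset.sum_congr rfl fun e _ => ?_
  rw [adjMat_symm ω e.1.2, adjMat_edge]
  ring

lemma integral_bern_exp {p : ℝ} (h0 : 0 ≤ p) (h1 : p ≤ 1) (c : ℝ) :
    ∫ x, Real.exp (c * bitVal x) ∂(bern p) = 1 + p * (Real.exp c - 1) := by
  unfold bern
  rw [PMF.integral_eq_sum, Fintype.sum_bool]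
  have hm : min p.toNNReal 1 = p.toNNReal := min_eq_left (by simpa using h1)
  have e1 : ((PMF.bernoulli (min p.toNNReal 1) (min_le_right _ _)) true).toReal = p := by
    rw [PMF.bernoulli_apply]
    simp [hm, h0]
  have e2 : ((PMF.bernoulli (min p.toNNReal 1) (min_le_right _ _)) false).toReal = 1 - p := by
    rw [PMF.bernoulli_apply]
    simp only [cond_false, ENNReal.coe_toReal]
    rw [NNReal.coe_sub (min_le_right _ _), hm]
    simp [h0]
  rw [e1, e2]
  simp [bitVal]
  ring

/-- Exponential Markov inequality for a weighted sum of independent Bernoulli variables. -/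
lemma measureReal_weighted_sum_ge_le {ι : Type*} [Fintype ι] (q : ι → ℝ)
    (h0 : ∀ e, 0 ≤ q e) (h1 : ∀ e, q e ≤ 1) (c : ι → ℝ) (t : ℝ) :
    (Measure.pi fun e => bern (q e)).real {ω | t ≤ ∑ e, c e * bitVal (ω e)} ≤
      Real.exp (∑ e, q e * (Real.exp (c e) - 1) - t) := by
  have h_integral : ∫ ω, Real.exp (∑ e, c e * bitVal (ω e)) ∂(Measure.pi fun e => bern (q e)) ≤
      Real.exp (∑ e, q e * (Real.exp (c e) - 1)) := by
    simp_rw [Real.exp_sum]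
    rw [integral_fintype_prod_eq_prod (fun e x => Real.exp (c e * bitVal x))]
    refine Finset.prod_le_prod (fun e _ => integral_nonneg fun _ => (Real.exp_pos _).le)
      fun e _ => ?_
    rw [integral_bern_exp (h0 e) (h1 e)]
    linarith [Real.add_one_le_exp (q e * (Real.exp (c e) - 1))]
  have hmk := mul_meas_ge_le_integral_of_nonneg
    (μ := Measure.pi fun e => bern (q e)) (f := fun ω => Real.exp (∑ e, c e * bitVal (ω e)))
    (Eventually.of_forall fun _ => (Real.exp_pos _).le) Integrable.of_finite (Real.exp t)
  simp only [Real.exp_le_exp] at hmk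
  rw [Real.exp_sub, le_div_iff₀ (Real.exp_pos t), mul_comm]
  exact hmk.trans h_integral

/-- Bernstein-type tail bound for a weighted sum of centered independent Bernoulli variables
with weights at most one in absolute value. -/
lemma measureReal_centered_sum_ge_le {ι : Type*} [Fintype ι] (q : ι → ℝ)
    (h0 : ∀ e, 0 ≤ q e) (h1 : ∀ e, q e ≤ 1) (c : ι → ℝ) (hc : ∀ e, |c e| ≤ 1) (t : ℝ) :
    (Measure.pi fun e => bern (q e)).real {ω | t ≤ ∑ e, c e * (bitVal (ω e) - q e)} ≤
      Real.exp (∑ e, q e * c e ^ 2 - t) := by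
  have hset : {ω : ι → Bool | t ≤ ∑ e, c e * (bitVal (ω e) - q e)} =
      {ω | t + ∑ e, c e * q e ≤ ∑ e, c e * bitVal (ω e)} := by
    ext ω
    simp only [Set.mem_ofPred_eq, mul_sub, Finset.sum_sub_distrib]
    exact ⟨fun h => by linarith, fun h => by linarith⟩
  rw [hset]
  refine (measureReal_weighted_sum_ge_le q h0 h1 c _).trans (Real.exp_le_exp.2 ?_)
  have hle : ∑ e, q e * (Real.exp (c e) - 1) ≤ ∑ e, (q e * c e ^ 2 + c e * q e) := by
    refine Finset.sum_le_sum fun e _ => ?_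
    have := (abs_le.1 (Real.abs_exp_sub_one_sub_id_le (hc e))).2
    nlinarith [h0 e]
  rw [Finset.sum_add_distrib] at hle
  linarith

/-- `log (e N / t)`, the entropy per element of the `t`-element subsets of an `N`-element
set. -/
noncomputable def entLog (N t : ℕ) : ℝ := 1 + Real.log N - Real.log t

lemma one_le_entLog {N t : ℕ} (ht : 1 ≤ t) (htN : t ≤ N) : 1 ≤ entLog N t := by
  have : Real.log t ≤ Real.log N :=
    Real.log_le_log (by exact_mod_cast ht) (by exact_mod_cast htN)
  unfold entLog; linarith

lemma one_add_log_le_mul_entLog {N t : ℕ} (ht : 1 ≤ t) (htN : t ≤ N) :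
    1 + Real.log N ≤ t * entLog N t := by
  have ht' : (1 : ℝ) ≤ t := by exact_mod_cast ht
  have h1 : Real.log t ≤ Real.log N :=
    Real.log_le_log (by exact_mod_cast ht) (by exact_mod_cast htN)
  have h2 := Real.log_le_sub_one_of_pos (show (0 : ℝ) < t by linarith)
  unfold entLog
  nlinarith

lemma card_filter_card_le_exp {N t : ℕ} (ht : 1 ≤ t) (htN : t ≤ N) :
    ((univ.filter fun S : Finset (Fin N) => S.card ≤ t).card : ℝ) ≤
      Real.exp (t * entLog N t) := by
  have ht0 : (0 : ℝ) < t := by exact_mod_cast ht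
  have hN0 : (0 : ℝ) < N := by exact_mod_cast lt_of_lt_of_le ht htN
  set x : ℝ := t / N with hx
  have hx0 : 0 < x := by positivity
  have hx1 : x ≤ 1 := by
    rw [hx, div_le_one hN0]; exact_mod_cast htN
  have h1 : ((univ.filter fun S : Finset (Fin N) => S.card ≤ t).card : ℝ) * x ^ t ≤
      ∑ S : Finset (Fin N), x ^ S.card := by
    rw [← nsmul_eq_mul]
    refine (Finset.card_nsmul_le_sum _ (fun S : Finset (Fin N) => x ^ S.card) _ fun S hS => ?_).trans
      (Finset.sum_le_sum_of_subset_of_nonneg (Finset.subset_univ _) fun _ _ _ => by positivity)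
    exact pow_le_pow_of_le_one hx0.le hx1 (by simpa using hS)
  have h2 : ∑ S : Finset (Fin N), x ^ S.card = (x + 1) ^ N := by
    simpa using Fintype.sum_pow_mul_eq_add_pow (Fin N) x 1
  have h3 : (x + 1) ^ N ≤ Real.exp t := by
    calc (x + 1) ^ N ≤ Real.exp x ^ N := pow_le_pow_left₀ (by positivity) (Real.add_one_le_exp x) N
      _ = Real.exp t := by
        rw [← Real.exp_nat_mul, hx]
        congr 1
        field_simp
  have h4 : x ^ t = Real.exp (t * (Real.log t - Real.log N)) := by
    rw [← Real.log_div ht0.ne' hN0.ne', ← hx, Real.exp_nat_mul, Real.exp_log hx0]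
  have h5 : Real.exp (t * entLog N t) * x ^ t = Real.exp t := by
    rw [h4, ← Real.exp_add]
    unfold entLog
    congr 1
    ring
  refine le_of_mul_le_mul_right ?_ (pow_pos hx0 t)
  rw [h5]
  linarith

lemma eCountC_eq_sum_adjMat {N : ℕ} (ω : Config N) (S T : Finset (Fin N)) :
    eCountC ω S T = ∑ i ∈ S, ∑ j ∈ T, adjMat ω i j := rfl

lemma eCountC_eq_sum_edgeIdx {N : ℕ} (ω : Config N) (S T : Finset (Fin N)) :
    eCountC ω S T = ∑ e : EdgeIdx N,
      ((if e.1.1 ∈ S ∧ e.1.2 ∈ T then 1 else 0) + (if e.1.2 ∈ S ∧ e.1.1 ∈ T then 1 else 0)) *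
        bitVal (ω e) := by
  rw [← sum_mul_adjMat ω fun i j => if i ∈ S ∧ j ∈ T then 1 else 0, eCountC_eq_sum_adjMat,
    ← Finset.sum_subset (Finset.subset_univ S)]
  · refine Finset.sum_congr rfl fun i hi => ?_
    rw [← Finset.sum_subset (Finset.subset_univ T)]
    · exact Finset.sum_congr rfl fun j hj => by simp [hi, hj]
    · intro j _ hj; simp [hj]
  · intro i _ hi; simp [hi]

lemma sum_edgeIdx_le_card_mul_card {N : ℕ} (S T : Finset (Fin N)) :
    ∑ e : EdgeIdx N,
      ((if e.1.1 ∈ S ∧ e.1.2 ∈ T then (1 : ℝ) else 0) +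
        (if e.1.2 ∈ S ∧ e.1.1 ∈ T then 1 else 0)) ≤ S.card * T.card := by
  refine (sum_edgeIdx_le_sum_sum (fun i j => if i ∈ S ∧ j ∈ T then (1 : ℝ) else 0)
    fun i j => by split_ifs <;> norm_num).trans_eq ?_
  calc ∑ i, ∑ j, (if i ∈ S ∧ j ∈ T then (1 : ℝ) else 0)
      = ∑ i, ∑ j, (if i ∈ S then (1 : ℝ) else 0) * (if j ∈ T then 1 else 0) := by
        refine Finset.sum_congr rfl fun i _ => Finset.sum_congr rfl fun j _ => ?_
        by_cases h1 : i ∈ S <;> by_cases h2 : j ∈ T <;> simp [h1, h2]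
    _ = S.card * T.card := by
        rw [← Finset.sum_mul_sum]
        simp

instance {N : ℕ} (p : Fin N → Fin N → ℝ) : IsProbabilityMeasure (genMeasure p) := by
  unfold genMeasure; infer_instance

lemma measureReal_eCountC_ge_le {N : ℕ} {p : Fin N → Fin N → ℝ} {δ : ℝ}
    (h0 : ∀ i j, 0 ≤ p i j) (h1 : ∀ i j, p i j ≤ 1) (hδ : ∀ i j, p i j ≤ δ)
    (S T : Finset (Fin N)) {l : ℝ} (hl : 0 ≤ l) (h : ℝ) (hδ0 : 0 ≤ δ) :
    (genMeasure p).real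
      {ω | δ * (S.card * T.card) * ((Real.exp (2 * l) - 1) / 2) + h ≤ l * eCountC ω S T} ≤
      Real.exp (-h) := by
  set m : EdgeIdx N → ℝ := fun e => (if e.1.1 ∈ S ∧ e.1.2 ∈ T then (1 : ℝ) else 0) +
        (if e.1.2 ∈ S ∧ e.1.1 ∈ T then 1 else 0) with hm
  have hset : ∀ ω : Config N, l * eCountC ω S T = ∑ e, (l * m e) * bitVal (ω e) := by
    intro ω
    rw [eCountC_eq_sum_edgeIdx, Finset.mul_sum]
    exact Finset.sum_congr rfl fun e _ => by rw [hm]; ring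
  simp_rw [hset]
  refine (measureReal_weighted_sum_ge_le _ (fun e => h0 _ _) (fun e => h1 _ _) _ _).trans
    (Real.exp_le_exp.2 ?_)
  have hE : 0 ≤ (Real.exp (2 * l) - 1) / 2 := by
    have := Real.one_le_exp (show 0 ≤ 2 * l by linarith)
    linarith
  have hpt : ∀ e : EdgeIdx N,
      p e.1.1 e.1.2 * (Real.exp (l * m e) - 1) ≤ δ * ((Real.exp (2 * l) - 1) / 2) * m e := by
    intro e
    have hsq : Real.exp (2 * l) = Real.exp l * Real.exp l := by rw [← Real.exp_add]; ring_nf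
    have hmE : 0 ≤ Real.exp (l * m e) - 1 ∧
        Real.exp (l * m e) - 1 ≤ ((Real.exp (2 * l) - 1) / 2) * m e := by
      have h1l := Real.one_le_exp hl
      have hcase : m e = 0 ∨ m e = 1 ∨ m e = 2 := by
        simp only [hm]; split_ifs <;> norm_num
      rcases hcase with h | h | h <;> rw [h]
      · simp
      · rw [mul_one, mul_one, hsq]
        constructor <;> nlinarith
      · rw [mul_comm l 2]
        constructor <;> nlinarith
    calc p e.1.1 e.1.2 * (Real.exp (l * m e) - 1) ≤ δ * (Real.exp (l * m e) - 1) :=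
          mul_le_mul_of_nonneg_right (hδ _ _) hmE.1
      _ ≤ δ * (((Real.exp (2 * l) - 1) / 2) * m e) := mul_le_mul_of_nonneg_left hmE.2 hδ0
      _ = _ := by ring
  have hsum := Finset.sum_le_sum fun e (_ : e ∈ (univ : Finset (EdgeIdx N))) => hpt e
  rw [← Finset.mul_sum] at hsum
  have hst := mul_le_mul_of_nonneg_left (sum_edgeIdx_le_card_mul_card S T) (mul_nonneg hδ0 hE)
  simp only [hm] at hsum ⊢
  linarith

/-- Discrepancy: uniformly over all pairs of vertex sets, the edge count has no large upward
deviation. The exponential parameter `l` may depend on the size of the larger set. -/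
lemma measureReal_not_discrepancy_le {N : ℕ} (hN : 1 ≤ N) {p : Fin N → Fin N → ℝ} {δ : ℝ}
    (h0 : ∀ i j, 0 ≤ p i j) (h1 : ∀ i j, p i j ≤ 1) (hδ : ∀ i j, p i j ≤ δ) (hδ0 : 0 ≤ δ)
    (l : ℕ → ℝ) (hl : ∀ t, 1 ≤ t → t ≤ N → 0 ≤ l t) :
    (genMeasure p).real
      {ω | ¬ ∀ S T : Finset (Fin N), S.card ≤ T.card → 1 ≤ T.card →
        l T.card * eCountC ω S T ≤ δ * (S.card * T.card) * ((Real.exp (2 * l T.card) - 1) / 2) +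
          6 * (T.card * entLog N T.card)} ≤ 1 / N := by
  set X : Finset (Fin N) → Finset (Fin N) → Set (Config N) := fun T S =>
    {ω | δ * (S.card * T.card) * ((Real.exp (2 * l T.card) - 1) / 2) +
          6 * (T.card * entLog N T.card) ≤ l T.card * eCountC ω S T} with hX
  have hN0 : (1 : ℝ) ≤ N := by exact_mod_cast hN
  have hsub : {ω : Config N | ¬ ∀ S T : Finset (Fin N), S.card ≤ T.card → 1 ≤ T.card →
        l T.card * eCountC ω S T ≤ δ * (S.card * T.card) * ((Real.exp (2 * l T.card) - 1) / 2) +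
          6 * (T.card * entLog N T.card)} ⊆
      ⋃ T ∈ univ.filter (fun T : Finset (Fin N) => 1 ≤ T.card),
        ⋃ S ∈ univ.filter (fun S : Finset (Fin N) => S.card ≤ T.card), X T S := by
    intro ω hω
    simp only [Set.mem_ofPred_eq, not_forall, not_le] at hω
    obtain ⟨S, T, hST, hT, h⟩ := hω
    simp only [Set.mem_iUnion, Finset.mem_filter, Finset.mem_univ, true_and]
    exact ⟨T, hT, S, hST, h.le⟩
  have hTN : ∀ T : Finset (Fin N), T.card ≤ N := fun T => by
    simpa using Finset.card_le_univ T
  have hinner : ∀ T ∈ univ.filter (fun T : Finset (Fin N) => 1 ≤ T.card),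
      (genMeasure p).real
        (⋃ S ∈ univ.filter (fun S : Finset (Fin N) => S.card ≤ T.card), X T S) ≤
      Real.exp (-(T.card * entLog N T.card)) * Real.exp (-4 * (1 + Real.log N)) := by
    intro T hT
    have hT1 : 1 ≤ T.card := by simpa using hT
    refine (measureReal_biUnion_finset_le _ _).trans ?_
    refine (Finset.sum_le_card_nsmul _ _ (Real.exp (-(6 * (T.card * entLog N T.card))))
      fun S _ => measureReal_eCountC_ge_le h0 h1 hδ S T (hl _ hT1 (hTN T)) _ hδ0).trans ?_
    rw [nsmul_eq_mul]
    refine (mul_le_mul_of_nonneg_right (card_filter_card_le_exp hT1 (hTN T))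
      (Real.exp_pos _).le).trans ?_
    rw [← Real.exp_add, ← Real.exp_add, Real.exp_le_exp]
    linarith [one_add_log_le_mul_entLog hT1 (hTN T)]
  have houter : ∑ T ∈ univ.filter (fun T : Finset (Fin N) => 1 ≤ T.card),
      Real.exp (-(T.card * entLog N T.card)) ≤ N := by
    have hmap : ∀ T ∈ univ.filter (fun T : Finset (Fin N) => 1 ≤ T.card),
        T.card ∈ Finset.Icc 1 N := by
      intro T hT
      exact Finset.mem_Icc.2 ⟨by simpa using hT, hTN T⟩
    rw [← Finset.sum_fiberwise_of_maps_to hmap]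
    calc _ ≤ ∑ t ∈ Finset.Icc 1 N, (1 : ℝ) := by
          refine Finset.sum_le_sum fun t ht => ?_
          obtain ⟨ht1, htN⟩ := Finset.mem_Icc.1 ht
          refine (Finset.sum_le_card_nsmul _ _ (Real.exp (-(t * entLog N t))) ?_).trans ?_
          · intro T hT
            rw [(Finset.mem_filter.1 hT).2]
          · rw [nsmul_eq_mul, Real.exp_neg, ← div_eq_mul_inv, div_le_one (Real.exp_pos _)]
            refine le_trans ?_ (card_filter_card_le_exp ht1 htN)
            exact_mod_cast Finset.card_le_card fun T hT => by
              simp only [Finset.mem_filter, Finset.mem_univ, true_and] at hT ⊢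
              exact hT.2.le
      _ = N := by simp
  calc _ ≤ (genMeasure p).real _ := measureReal_mono hsub (measure_ne_top _ _)
    _ ≤ _ := measureReal_biUnion_finset_le _ _
    _ ≤ _ := Finset.sum_le_sum hinner
    _ ≤ N * Real.exp (-4 * (1 + Real.log N)) := by
        rw [← Finset.sum_mul]
        exact mul_le_mul_of_nonneg_right houter (Real.exp_pos _).le
    _ ≤ N * Real.exp (-2 * Real.log N) := by
        refine mul_le_mul_of_nonneg_left (Real.exp_le_exp.2 ?_) (by linarith)
        linarith [Real.log_nonneg hN0]
    _ = 1 / N := by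
        rw [show -2 * Real.log N = -(Real.log N + Real.log N) by ring, Real.exp_neg, Real.exp_add,
          Real.exp_log (by linarith)]
        field_simp

/-- The integer vectors of squared Euclidean norm at most `16 N`. -/
noncomputable def gridVecs (N : ℕ) : Finset (Fin N → ℤ) :=
  (Fintype.piFinset fun _ => Finset.Icc (-(16 * N : ℤ)) (16 * N)).filter
    fun z => ∑ i, z i ^ 2 ≤ 16 * N

lemma mem_gridVecs {N : ℕ} {z : Fin N → ℤ} :
    z ∈ gridVecs N ↔ ∑ i, (z i : ℝ) ^ 2 ≤ 16 * N := by
  have hcast : ∑ i, (z i : ℝ) ^ 2 ≤ 16 * N ↔ ∑ i, z i ^ 2 ≤ 16 * (N : ℤ) := by exact_mod_cast Iff.rfl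
  rw [hcast]
  simp only [gridVecs, Finset.mem_filter, Fintype.mem_piFinset, Finset.mem_Icc,
    and_iff_right_iff_imp]
  intro h i
  have h1 : z i ^ 2 ≤ 16 * N :=
    (Finset.single_le_sum (f := fun i => z i ^ 2) (fun i _ => sq_nonneg (z i))
      (Finset.mem_univ i)).trans h
  have h2 : |z i| ≤ z i ^ 2 := by
    rw [← sq_abs]
    rcases (abs_nonneg (z i)).eq_or_lt with h0 | h0
    · simp [← h0]
    · nlinarith
  exact abs_le.1 (h2.trans h1)

lemma sum_Icc_half_pow_natAbs_le (B : ℕ) :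
    ∑ k ∈ Finset.Icc (-(B : ℤ)) B, (1 / 2 : ℝ) ^ k.natAbs ≤ 3 - 2 * (1 / 2) ^ B := by
  induction B with
  | zero => norm_num
  | succ B ih =>
    have hI : Finset.Icc (-((B + 1 : ℕ) : ℤ)) ((B + 1 : ℕ) : ℤ) =
        insert (-((B + 1 : ℕ) : ℤ)) (insert ((B + 1 : ℕ) : ℤ) (Finset.Icc (-(B : ℤ)) B)) := by
      ext k
      simp only [Finset.mem_Icc, Finset.mem_insert]
      omega
    rw [hI, Finset.sum_insert (by simp; omega), Finset.sum_insert (by simp),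
      Int.natAbs_neg, Int.natAbs_natCast]
    rw [pow_succ]
    linarith

lemma card_gridVecs_le (N : ℕ) : ((gridVecs N).card : ℝ) ≤ Real.exp (18 * N) := by
  have h1 : ((gridVecs N).card : ℝ) * (1 / 2) ^ (16 * N) ≤
      ∑ z ∈ Fintype.piFinset fun _ : Fin N => Finset.Icc (-(16 * N : ℤ)) (16 * N),
        ∏ i, (1 / 2 : ℝ) ^ (z i).natAbs := by
    rw [← nsmul_eq_mul]
    refine (Finset.card_nsmul_le_sum _
      (fun z : Fin N → ℤ => ∏ i, (1 / 2 : ℝ) ^ (z i).natAbs) _ fun z hz => ?_).trans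
      (Finset.sum_le_sum_of_subset_of_nonneg (Finset.filter_subset _ _)
        fun _ _ _ => by positivity)
    rw [Finset.prod_pow_eq_pow_sum]
    refine pow_le_pow_of_le_one (by norm_num) (by norm_num) ?_
    have h := (Finset.mem_filter.1 hz).2
    zify
    refine le_trans (Finset.sum_le_sum fun i _ => ?_) h
    rw [← sq_abs]
    rcases (abs_nonneg (z i)).eq_or_lt with h0 | h0
    · simp [← h0]
    · nlinarith
  rw [← Finset.prod_univ_sum (fun _ : Fin N => Finset.Icc (-(16 * N : ℤ)) (16 * N))
    fun _ k => (1 / 2 : ℝ) ^ k.natAbs] at h1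
  have h2 : ∑ k ∈ Finset.Icc (-(16 * N : ℤ)) (16 * N), (1 / 2 : ℝ) ^ k.natAbs ≤ 4 := by
    have h := sum_Icc_half_pow_natAbs_le (16 * N)
    push_cast at h
    have : (0 : ℝ) < (1 / 2) ^ (16 * N) := by positivity
    linarith
  have h3 : ∏ _i : Fin N, ∑ k ∈ Finset.Icc (-(16 * N : ℤ)) (16 * N), (1 / 2 : ℝ) ^ k.natAbs ≤
      4 ^ N := by
    rw [Finset.prod_const, Finset.card_univ, Fintype.card_fin]
    exact pow_le_pow_left₀ (Finset.sum_nonneg fun _ _ => by positivity) h2 N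
  have h4 : ((gridVecs N).card : ℝ) ≤ (2 : ℝ) ^ (18 * N) := by
    have h5 := h1.trans h3
    rw [one_div, inv_pow, ← div_eq_mul_inv, div_le_iff₀ (by positivity)] at h5
    refine h5.trans_eq ?_
    rw [show (4 : ℝ) = 2 ^ 2 by norm_num, ← pow_mul, ← pow_add]
    congr 1
    ring
  refine h4.trans ?_
  have h6 : (2 : ℝ) ≤ Real.exp 1 := by
    have := Real.add_one_le_exp (1 : ℝ)
    linarith
  calc (2 : ℝ) ^ (18 * N) ≤ Real.exp 1 ^ (18 * N) := pow_le_pow_left₀ (by norm_num) h6 _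
    _ = Real.exp (18 * N) := by rw [← Real.exp_nat_mul]; push_cast; ring_nf

/-- The dyadic level of an integer. -/
def dyadicLevel (k : ℤ) : ℕ := Nat.log 2 k.natAbs

lemma abs_le_two_pow_dyadicLevel (k : ℤ) : |(k : ℝ)| ≤ 2 * 2 ^ dyadicLevel k := by
  have h := (Nat.lt_pow_succ_log_self (b := 2) (by norm_num) k.natAbs).le
  rw [← Int.cast_abs, ← Nat.cast_natAbs]
  rw [Nat.succ_eq_add_one, pow_succ'] at h
  unfold dyadicLevel
  exact_mod_cast h

lemma two_pow_dyadicLevel_le {k : ℤ} (hk : k ≠ 0) : (2 : ℝ) ^ dyadicLevel k ≤ |(k : ℝ)| := by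
  have h := Nat.pow_log_le_self 2 (Int.natAbs_ne_zero.2 hk)
  rw [← Int.cast_abs, ← Nat.cast_natAbs]
  unfold dyadicLevel
  exact_mod_cast h

/-- The coefficients `z u * w v` of the light couples, those at levels `i`, `j` with
`2 ^ (i + j) ≤ √D`. -/
noncomputable def lightCoef {N : ℕ} (D : ℝ) (z w : Fin N → ℤ) (u v : Fin N) : ℝ :=
  if (2 : ℝ) ^ (dyadicLevel (z u) + dyadicLevel (w v)) ≤ √D then (z u : ℝ) * w v else 0

lemma abs_lightCoef_le {N : ℕ} (D : ℝ) (z w : Fin N → ℤ) (u v : Fin N) :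
    |lightCoef D z w u v| ≤ 4 * √D := by
  unfold lightCoef
  split_ifs with h
  · rw [abs_mul]
    refine (mul_le_mul (abs_le_two_pow_dyadicLevel _) (abs_le_two_pow_dyadicLevel _)
      (abs_nonneg _) (by positivity)).trans ?_
    rw [pow_add] at h
    linarith
  · simp

lemma lightCoef_sq_le {N : ℕ} (D : ℝ) (z w : Fin N → ℤ) (u v : Fin N) :
    lightCoef D z w u v ^ 2 ≤ (z u : ℝ) ^ 2 * (w v : ℝ) ^ 2 := by
  unfold lightCoef
  split_ifs
  · rw [mul_pow]
  · rw [zero_pow two_ne_zero]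
    positivity

lemma sum_sq_mul_sq_le {N : ℕ} {z w : Fin N → ℤ} (hz : z ∈ gridVecs N) (hw : w ∈ gridVecs N) :
    ∑ u, ∑ v, (z u : ℝ) ^ 2 * (w v : ℝ) ^ 2 ≤ 256 * N ^ 2 := by
  rw [← Finset.sum_mul_sum]
  refine (mul_le_mul (mem_gridVecs.1 hz) (mem_gridVecs.1 hw)
    (Finset.sum_nonneg fun _ _ => sq_nonneg _) (by positivity)).trans_eq (by ring)

lemma measureReal_light_ge_le {N : ℕ} (hN : 1 ≤ N) {p : Fin N → Fin N → ℝ} {D : ℝ} (hD : 0 < D)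
    (h0 : ∀ i j, 0 ≤ p i j) (h1 : ∀ i j, p i j ≤ 1) (hδ : ∀ i j, p i j ≤ D / N)
    (hsymm : ∀ i j, p i j = p j i) (hdiag : ∀ i, p i i = 0)
    {z w : Fin N → ℤ} (hz : z ∈ gridVecs N) (hw : w ∈ gridVecs N) :
    (genMeasure p).real {ω | 360 * √D * N ≤
      ∑ u, ∑ v, lightCoef D z w u v * (adjMat ω u v - p u v)} ≤ Real.exp (-(37 * N)) := by
  have hN0 : (0 : ℝ) < N := by exact_mod_cast hN
  have hs : 0 < √D := Real.sqrt_pos.2 hD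
  have hss : √D * √D = D := Real.mul_self_sqrt hD.le
  set g := lightCoef D z w with hg
  set c : EdgeIdx N → ℝ := fun e => (g e.1.1 e.1.2 + g e.1.2 e.1.1) / (8 * √D) with hc
  have hsum : ∀ ω : Config N, ∑ u, ∑ v, g u v * (adjMat ω u v - p u v) =
      (8 * √D) * ∑ e, c e * (bitVal (ω e) - p e.1.1 e.1.2) := by
    intro ω
    rw [sum_sum_eq_sum_edgeIdx _ (by simp [adjMat_self, hdiag]), Finset.mul_sum]
    refine Finset.sum_congr rfl fun e _ => ?_
    rw [adjMat_symm ω e.1.2, hsymm e.1.2, adjMat_edge, hc]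
    field_simp
  have hset : {ω : Config N | 360 * √D * N ≤ ∑ u, ∑ v, g u v * (adjMat ω u v - p u v)} =
      {ω | 45 * (N : ℝ) ≤ ∑ e, c e * (bitVal (ω e) - p e.1.1 e.1.2)} := by
    ext ω
    simp only [Set.mem_ofPred_eq, hsum]
    rw [show 360 * √D * N = (8 * √D) * (45 * N) by ring]
    exact mul_le_mul_iff_right₀ (by positivity)
  have hc1 : ∀ e, |c e| ≤ 1 := by
    intro e
    rw [hc]
    simp only
    rw [abs_div, abs_of_pos (show 0 < 8 * √D by positivity), div_le_one (by positivity)]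
    refine (abs_add_le _ _).trans ?_
    linarith [abs_lightCoef_le D z w e.1.1 e.1.2, abs_lightCoef_le D z w e.1.2 e.1.1]
  rw [hset]
  refine (measureReal_centered_sum_ge_le _ (fun e => h0 _ _) (fun e => h1 _ _) c hc1 _).trans
    (Real.exp_le_exp.2 ?_)
  have hpt : ∀ e : EdgeIdx N, p e.1.1 e.1.2 * c e ^ 2 ≤
      1 / (32 * N) * (g e.1.1 e.1.2 ^ 2 + g e.1.2 e.1.1 ^ 2) := by
    intro e
    have hc2 : c e ^ 2 = (g e.1.1 e.1.2 + g e.1.2 e.1.1) ^ 2 / (64 * D) := by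
      rw [hc]
      simp only
      rw [div_pow, mul_pow, Real.sq_sqrt hD.le]
      norm_num
    calc p e.1.1 e.1.2 * c e ^ 2 ≤ D / N * c e ^ 2 :=
          mul_le_mul_of_nonneg_right (hδ _ _) (sq_nonneg _)
      _ = 1 / (64 * N) * (g e.1.1 e.1.2 + g e.1.2 e.1.1) ^ 2 := by
          rw [hc2]; field_simp
      _ ≤ 1 / (64 * N) * (2 * (g e.1.1 e.1.2 ^ 2 + g e.1.2 e.1.1 ^ 2)) := by
          refine mul_le_mul_of_nonneg_left ?_ (by positivity)
          nlinarith [sq_nonneg (g e.1.1 e.1.2 - g e.1.2 e.1.1)]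
      _ = _ := by field_simp; ring
  have h2 := Finset.sum_le_sum fun e (_ : e ∈ (univ : Finset (EdgeIdx N))) => hpt e
  rw [← Finset.mul_sum] at h2
  have h3 : ∑ e : EdgeIdx N, (g e.1.1 e.1.2 ^ 2 + g e.1.2 e.1.1 ^ 2) ≤ 256 * N ^ 2 :=
    (sum_edgeIdx_le_sum_sum (fun u v => g u v ^ 2) fun _ _ => sq_nonneg _).trans
      ((Finset.sum_le_sum fun u _ => Finset.sum_le_sum fun v _ =>
        lightCoef_sq_le D z w u v).trans (sum_sq_mul_sq_le hz hw))
  have h4 := mul_le_mul_of_nonneg_left h3 (show (0 : ℝ) ≤ 1 / (32 * N) by positivity)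
  have h5 : 1 / (32 * (N : ℝ)) * (256 * N ^ 2) = 8 * N := by field_simp; norm_num
  linarith

/-- Uniform control of the light couples over all pairs of grid vectors. -/
lemma measureReal_not_light_le {N : ℕ} (hN : 1 ≤ N) {p : Fin N → Fin N → ℝ} {D : ℝ} (hD : 0 < D)
    (h0 : ∀ i j, 0 ≤ p i j) (h1 : ∀ i j, p i j ≤ 1) (hδ : ∀ i j, p i j ≤ D / N)
    (hsymm : ∀ i j, p i j = p j i) (hdiag : ∀ i, p i i = 0) :
    (genMeasure p).real {ω | ¬ ∀ z ∈ gridVecs N, ∀ w ∈ gridVecs N,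
      ∑ u, ∑ v, lightCoef D z w u v * (adjMat ω u v - p u v) ≤ 360 * √D * N} ≤
      Real.exp (-N) := by
  set X : (Fin N → ℤ) × (Fin N → ℤ) → Set (Config N) := fun x =>
    {ω | 360 * √D * N ≤ ∑ u, ∑ v, lightCoef D x.1 x.2 u v * (adjMat ω u v - p u v)} with hX
  have hsub : {ω : Config N | ¬ ∀ z ∈ gridVecs N, ∀ w ∈ gridVecs N,
      ∑ u, ∑ v, lightCoef D z w u v * (adjMat ω u v - p u v) ≤ 360 * √D * N} ⊆
      ⋃ x ∈ gridVecs N ×ˢ gridVecs N, X x := by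
    intro ω hω
    simp only [Set.mem_ofPred_eq, not_forall, not_le] at hω
    obtain ⟨z, hz, w, hw, h⟩ := hω
    simp only [Set.mem_iUnion]
    exact ⟨(z, w), Finset.mem_product.2 ⟨hz, hw⟩, h.le⟩
  refine (measureReal_mono hsub (measure_ne_top _ _)).trans
    ((measureReal_biUnion_finset_le _ _).trans ?_)
  refine (Finset.sum_le_card_nsmul _ _ (Real.exp (-(37 * N))) fun x hx =>
    measureReal_light_ge_le hN hD h0 h1 hδ hsymm hdiag (Finset.mem_product.1 hx).1
      (Finset.mem_product.1 hx).2).trans ?_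
  rw [nsmul_eq_mul, Finset.card_product, Nat.cast_mul]
  calc _ ≤ Real.exp (18 * N) * Real.exp (18 * N) * Real.exp (-(37 * N)) := by
        have := card_gridVecs_le N
        gcongr
    _ = Real.exp (-N) := by
        rw [← Real.exp_add, ← Real.exp_add]
        congr 1
        ring

lemma sum_two_pow_ite_le {X : ℝ} (hX : 0 ≤ X) (L : ℕ) :
    ∑ i ∈ Finset.range L, (if (2 : ℝ) ^ i ≤ X then (2 : ℝ) ^ i else 0) ≤ 2 * X := by
  have hgeom : ∀ L : ℕ,
      ∑ i ∈ Finset.range L, (if (2 : ℝ) ^ i ≤ X then (2 : ℝ) ^ i else 0) ≤ 2 ^ L := by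
    intro L
    induction L with
    | zero => simp
    | succ L ih =>
      rw [Finset.sum_range_succ, pow_succ]
      have : (if (2 : ℝ) ^ L ≤ X then (2 : ℝ) ^ L else 0) ≤ 2 ^ L := by
        split_ifs
        exacts [le_rfl, by positivity]
      linarith
  induction L with
  | zero => simpa using hX
  | succ L ih =>
    rw [Finset.sum_range_succ]
    split_ifs with h
    · linarith [hgeom L]
    · linarith

lemma sum_three_quarters_pow_le (L : ℕ) : ∑ j ∈ Finset.range L, (3 / 4 : ℝ) ^ j ≤ 4 := by
  rw [geom_sum_eq (by norm_num)]
  have h : (0 : ℝ) < (3 / 4) ^ L := by positivity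
  have h2 : ((3 / 4 : ℝ) ^ L - 1) / (3 / 4 - 1) = 4 - 4 * (3 / 4) ^ L := by ring
  linarith

/-- Summation over dyadic levels in the Kahn–Szemerédi argument: `e i j` plays the role of the
number of edges between the `i`-th and the `j`-th level sets, whose sizes are `s i` and `t j`,
and `r ^ 2` that of the average degree. -/
lemma sum_heavy_levels_le {N r : ℝ} (hN : 0 < N) (hr : 0 < r) (L : ℕ) (s t φ : ℕ → ℝ)
    (e : ℕ → ℕ → ℝ) (hs : ∀ i, 0 ≤ s i) (ht : ∀ j, 0 ≤ t j)
    (he : ∀ i j, 0 ≤ e i j)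
    (hsum_s : ∑ i ∈ Finset.range L, 4 ^ i * s i ≤ 16 * N)
    (hsum_t : ∑ j ∈ Finset.range L, 4 ^ j * t j ≤ 16 * N)
    (hdeg : ∀ i, ∑ j ∈ Finset.range L, e i j ≤ 10 * r ^ 2 * s i)
    (h1 : ∀ i j, s i ≤ t j → e i j ≤ 4 * (r ^ 2 / N) * (s i * t j) + 24 * φ j)
    (h2 : ∀ i j, s i ≤ t j → e i j ≤ 4 * (r ^ 2 / N) * (s i * φ j) + 48 * t j)
    (hφ2 : ∀ j < L, 2 ^ j * φ j ≤ 12 * N * (3 / 4) ^ j) :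
    ∑ i ∈ Finset.range L, ∑ j ∈ Finset.range L,
      (if s i ≤ t j ∧ r < 2 ^ (i + j) then 2 ^ (i + j) * e i j else 0) ≤ 8096 * r * N := by
  have h4 : ∀ i : ℕ, (4 : ℝ) ^ i = 2 ^ i * 2 ^ i := fun i => by
    rw [← mul_pow]; norm_num
  have hpt : ∀ i ∈ Finset.range L, ∀ j ∈ Finset.range L,
      (if s i ≤ t j ∧ r < 2 ^ (i + j) then 2 ^ (i + j) * e i j else 0) ≤
        4 ^ i / r * e i j + 4 * r / N * ((4 ^ i * s i) * (4 ^ j * t j)) +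
        288 * N * ((if (2 : ℝ) ^ i ≤ r then 2 ^ i else 0) * (3 / 4) ^ j) +
        48 * r * ((4 ^ i * s i) * (3 / 4) ^ j) +
        48 * ((2 ^ j * t j) * (if (2 : ℝ) ^ i ≤ r * 2 ^ j then 2 ^ i else 0)) := by
    intro i _ j hj
    have hφj := hφ2 j (Finset.mem_range.1 hj)
    have hsi := hs i
    have htj := ht j
    have hpi : (0 : ℝ) < 2 ^ i := by positivity
    have hpj : (0 : ℝ) < 2 ^ j := by positivity
    have hA : 0 ≤ 4 ^ i / r * e i j := mul_nonneg (by positivity) (he i j)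
    have hB : 0 ≤ 4 * r / N * ((4 ^ i * s i) * (4 ^ j * t j)) := by positivity
    have hC : 0 ≤ 288 * N * ((if (2 : ℝ) ^ i ≤ r then 2 ^ i else 0) * (3 / 4) ^ j) := by
      split_ifs <;> positivity
    have hD : 0 ≤ 48 * r * ((4 ^ i * s i) * (3 / 4 : ℝ) ^ j) := by positivity
    have hE : 0 ≤ 48 * ((2 ^ j * t j) * (if (2 : ℝ) ^ i ≤ r * 2 ^ j then 2 ^ i else 0)) := by
      split_ifs <;> positivity
    by_cases hcond : s i ≤ t j ∧ r < 2 ^ (i + j)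
    swap
    · rw [if_neg hcond]; positivity
    rw [if_pos hcond]
    obtain ⟨hst, hheavy⟩ := hcond
    rw [pow_add] at hheavy ⊢
    by_cases hc1 : r * 2 ^ j ≤ 2 ^ i
    · have : 2 ^ i * 2 ^ j * e i j ≤ 4 ^ i / r * e i j := by
        refine mul_le_mul_of_nonneg_right ?_ (he i j)
        rw [le_div_iff₀ hr, h4]
        nlinarith
      linarith
    push Not at hc1
    rw [if_pos hc1.le] at hE ⊢
    by_cases hc2 : (2 : ℝ) ^ i ≤ r
    · rw [if_pos hc2] at hC ⊢
      have hb := mul_le_mul_of_nonneg_left (h1 i j hst) (mul_pos hpi hpj).le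
      have hb1 : 2 ^ i * 2 ^ j * (4 * (r ^ 2 / N) * (s i * t j)) ≤
          4 * r / N * ((4 ^ i * s i) * (4 ^ j * t j)) := by
        rw [h4, h4]
        calc 2 ^ i * 2 ^ j * (4 * (r ^ 2 / N) * (s i * t j))
            = (4 * r / N * (s i * t j) * (2 ^ i * 2 ^ j)) * r := by ring
          _ ≤ (4 * r / N * (s i * t j) * (2 ^ i * 2 ^ j)) * (2 ^ i * 2 ^ j) :=
            mul_le_mul_of_nonneg_left hheavy.le (by positivity)
          _ = _ := by ring
      have hb2 : 2 ^ i * 2 ^ j * (24 * φ j) ≤ 288 * N * (2 ^ i * (3 / 4) ^ j) := by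
        calc 2 ^ i * 2 ^ j * (24 * φ j) = 24 * 2 ^ i * (2 ^ j * φ j) := by ring
          _ ≤ 24 * 2 ^ i * (12 * N * (3 / 4) ^ j) :=
            mul_le_mul_of_nonneg_left hφj (by positivity)
          _ = _ := by ring
      linarith
    · rw [if_neg hc2] at hC ⊢
      push Not at hc2
      have hb := mul_le_mul_of_nonneg_left (h2 i j hst) (mul_pos hpi hpj).le
      have hb1 : 2 ^ i * 2 ^ j * (4 * (r ^ 2 / N) * (s i * φ j)) ≤
          48 * r * ((4 ^ i * s i) * (3 / 4) ^ j) := by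
        rw [h4]
        calc 2 ^ i * 2 ^ j * (4 * (r ^ 2 / N) * (s i * φ j))
            = 4 * r / N * 2 ^ i * s i * (2 ^ j * φ j) * r := by ring
          _ ≤ 4 * r / N * 2 ^ i * s i * (12 * N * (3 / 4) ^ j) * 2 ^ i := by
            refine mul_le_mul (mul_le_mul_of_nonneg_left hφj (by positivity)) hc2.le hr.le
              (by positivity)
          _ = 48 * r * ((2 ^ i * 2 ^ i * s i) * (3 / 4) ^ j) := by field_simp; ring
      have hb2 : 2 ^ i * 2 ^ j * (48 * t j) = 48 * ((2 ^ j * t j) * 2 ^ i) := by ring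
      linarith
  refine (Finset.sum_le_sum fun i hi => Finset.sum_le_sum fun j hj => hpt i hi j hj).trans ?_
  simp only [Finset.sum_add_distrib]
  have hs0 : 0 ≤ ∑ i ∈ Finset.range L, 4 ^ i * s i :=
    Finset.sum_nonneg fun i _ => mul_nonneg (by positivity) (hs i)
  have ht0 : 0 ≤ ∑ j ∈ Finset.range L, 4 ^ j * t j :=
    Finset.sum_nonneg fun i _ => mul_nonneg (by positivity) (ht i)
  have hg0 : 0 ≤ ∑ j ∈ Finset.range L, (3 / 4 : ℝ) ^ j :=
    Finset.sum_nonneg fun i _ => by positivity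
  have hg := sum_three_quarters_pow_le L
  have S1 : ∑ i ∈ Finset.range L, ∑ j ∈ Finset.range L, 4 ^ i / r * e i j ≤ 160 * r * N := by
    calc _ ≤ ∑ i ∈ Finset.range L, 10 * r * (4 ^ i * s i) := by
          refine Finset.sum_le_sum fun i _ => ?_
          rw [← Finset.mul_sum]
          refine (mul_le_mul_of_nonneg_left (hdeg i) (by positivity)).trans_eq ?_
          field_simp
      _ ≤ _ := by
          rw [← Finset.mul_sum]
          nlinarith
  have S2 : ∑ i ∈ Finset.range L, ∑ j ∈ Finset.range L,
      4 * r / N * ((4 ^ i * s i) * (4 ^ j * t j)) ≤ 1024 * r * N := by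
    simp only [← Finset.mul_sum]
    rw [← Finset.sum_mul]
    calc _ ≤ 4 * r / N * ((16 * N) * (16 * N)) := by
          refine mul_le_mul_of_nonneg_left ?_ (by positivity)
          exact mul_le_mul hsum_s hsum_t ht0 (by positivity)
      _ = _ := by field_simp; ring
  have S3 : ∑ i ∈ Finset.range L, ∑ j ∈ Finset.range L,
      288 * N * ((if (2 : ℝ) ^ i ≤ r then 2 ^ i else 0) * (3 / 4) ^ j) ≤ 2304 * r * N := by
    simp only [← Finset.mul_sum]
    rw [← Finset.sum_mul]
    calc _ ≤ 288 * N * ((2 * r) * 4) := by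
          refine mul_le_mul_of_nonneg_left ?_ (by positivity)
          exact mul_le_mul (sum_two_pow_ite_le hr.le L) hg hg0 (by positivity)
      _ = _ := by ring
  have S4 : ∑ i ∈ Finset.range L, ∑ j ∈ Finset.range L,
      48 * r * ((4 ^ i * s i) * (3 / 4 : ℝ) ^ j) ≤ 3072 * r * N := by
    simp only [← Finset.mul_sum]
    rw [← Finset.sum_mul]
    calc _ ≤ 48 * r * ((16 * N) * 4) := by
          refine mul_le_mul_of_nonneg_left ?_ (by positivity)
          exact mul_le_mul hsum_s hg hg0 (by positivity)
      _ = _ := by ring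
  have S5 : ∑ i ∈ Finset.range L, ∑ j ∈ Finset.range L,
      48 * ((2 ^ j * t j) * (if (2 : ℝ) ^ i ≤ r * 2 ^ j then 2 ^ i else 0)) ≤ 1536 * r * N := by
    rw [Finset.sum_comm]
    calc _ ≤ ∑ j ∈ Finset.range L, 96 * r * (4 ^ j * t j) := by
          refine Finset.sum_le_sum fun j _ => ?_
          rw [← Finset.mul_sum, ← Finset.mul_sum]
          have hb := mul_le_mul_of_nonneg_left
            (sum_two_pow_ite_le (X := r * 2 ^ j) (by positivity) L)
            (mul_nonneg (by positivity : (0 : ℝ) ≤ 2 ^ j) (ht j))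
          rw [h4]
          linarith
      _ ≤ _ := by
          rw [← Finset.mul_sum]
          nlinarith
  linarith

/-- The weight `t * (e N / t) ^ (1 / 4)`. -/
noncomputable def entWeight (N t : ℕ) : ℝ := t * Real.exp (entLog N t / 4)

lemma two_pow_mul_entWeight_le {N t j : ℕ} (hN : 1 ≤ N) (ht : (4 : ℝ) ^ j * t ≤ 16 * N) :
    2 ^ j * entWeight N t ≤ 12 * N * (3 / 4) ^ j := by
  rcases Nat.eq_zero_or_pos t with rfl | ht0
  · simp only [entWeight, Nat.cast_zero, zero_mul, mul_zero]
    positivity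
  have htR : (0 : ℝ) < t := by exact_mod_cast ht0
  have hNR : (0 : ℝ) < N := by exact_mod_cast hN
  have hexp : Real.exp (entLog N t) ≤ 3 * (N / t) := by
    unfold entLog
    rw [add_sub_assoc, Real.exp_add, ← Real.log_div hNR.ne' htR.ne', Real.exp_log (by positivity)]
    have := Real.exp_one_lt_d9
    have h3 : Real.exp 1 ≤ 3 := by linarith
    exact mul_le_mul_of_nonneg_right h3 (by positivity)
  refine le_of_pow_le_pow_left₀ (n := 4) (by norm_num) (by positivity) ?_
  have hφ4 : (2 ^ j * entWeight N t) ^ 4 = 16 ^ j * t ^ 4 * Real.exp (entLog N t) := by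
    unfold entWeight
    rw [mul_pow, mul_pow, ← Real.exp_nat_mul, ← pow_mul, mul_comm j 4, pow_mul]
    push_cast
    rw [mul_div_cancel₀ _ (by norm_num : (4 : ℝ) ≠ 0)]
    norm_num
    ring
  have hcube : ((4 : ℝ) ^ j * t) ^ 3 ≤ (16 * N) ^ 3 := pow_le_pow_left₀ (by positivity) ht 3
  have h81 : (1 / 4 : ℝ) ^ j ≤ (81 / 256) ^ j := pow_le_pow_left₀ (by norm_num) (by norm_num) j
  have h16 : (16 : ℝ) ^ j * t ^ 3 = ((4 : ℝ) ^ j * t) ^ 3 * (1 / 4) ^ j := by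
    rw [mul_pow, ← pow_mul, mul_comm j 3, pow_mul, mul_right_comm, ← mul_pow]
    norm_num
  have hrhs : (12 * (N : ℝ) * (3 / 4) ^ j) ^ 4 = 20736 * N ^ 4 * (81 / 256) ^ j := by
    rw [mul_pow, mul_pow, ← pow_mul, mul_comm j 4, pow_mul]
    norm_num
  rw [hφ4, hrhs]
  calc (16 : ℝ) ^ j * t ^ 4 * Real.exp (entLog N t) ≤ 16 ^ j * t ^ 4 * (3 * (N / t)) :=
        mul_le_mul_of_nonneg_left hexp (by positivity)
    _ = 3 * N * (16 ^ j * t ^ 3) := by field_simp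
    _ = 3 * N * ((4 ^ j * t) ^ 3 * (1 / 4) ^ j) := by rw [h16]
    _ ≤ 3 * N * ((16 * N) ^ 3 * (81 / 256) ^ j) := by gcongr
    _ ≤ _ := by
        have : (0 : ℝ) ≤ N ^ 4 * (81 / 256) ^ j := by positivity
        nlinarith

/-- The discrepancy property of a configuration with average degree of order `D`. -/
def HasDiscrepancy {N : ℕ} (D : ℝ) (ω : Config N) : Prop :=
  ∀ S T : Finset (Fin N), S.card ≤ T.card →
    eCountC ω S T ≤ 4 * (D / N) * (S.card * T.card) + 24 * entWeight N T.card ∧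
    eCountC ω S T ≤ 4 * (D / N) * (S.card * entWeight N T.card) + 48 * T.card

lemma eCountC_nonneg {N : ℕ} (ω : Config N) (S T : Finset (Fin N)) : 0 ≤ eCountC ω S T :=
  Finset.sum_nonneg fun i _ => Finset.sum_nonneg fun j _ => adjMat_nonneg ω i j

lemma eCountC_comm {N : ℕ} (ω : Config N) (S T : Finset (Fin N)) :
    eCountC ω S T = eCountC ω T S := by
  rw [eCountC_eq_sum_adjMat, eCountC_eq_sum_adjMat]
  refine Finset.sum_comm.trans ?_
  exact Finset.sum_congr rfl fun i _ => Finset.sum_congr rfl fun j _ => adjMat_symm ω j i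

lemma measureReal_not_hasDiscrepancy_le {N : ℕ} (hN : 1 ≤ N) {p : Fin N → Fin N → ℝ} {D : ℝ}
    (hD : 0 < D) (h0 : ∀ i j, 0 ≤ p i j) (h1 : ∀ i j, p i j ≤ 1) (hδ : ∀ i j, p i j ≤ D / N) :
    (genMeasure p).real {ω | ¬ HasDiscrepancy D ω} ≤ 2 / N := by
  have hδ0 : 0 ≤ D / N := by positivity
  have hA := measureReal_not_discrepancy_le hN h0 h1 hδ hδ0 (fun _ => 1) fun _ _ _ => zero_le_one
  have hB := measureReal_not_discrepancy_le hN h0 h1 hδ hδ0 (fun t => entLog N t / 8)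
    fun t ht htN => by linarith [one_le_entLog ht htN]
  refine le_trans ?_ ((add_le_add hA hB).trans_eq (by ring))
  refine (measureReal_mono (fun ω hω => ?_) (measure_ne_top _ _)).trans (measureReal_union_le _ _)
  by_contra hcon
  simp only [Set.mem_union, Set.mem_ofPred_eq, not_or, not_not] at hcon
  refine hω fun S T hST => ?_
  rcases Nat.eq_zero_or_pos T.card with hT | hT
  · have hT0 : T = ∅ := Finset.card_eq_zero.1 hT
    simp [hT0, eCountC, entWeight]
  have ht1 : (1 : ℝ) ≤ T.card := by exact_mod_cast hT
  have hTN : T.card ≤ N := by simpa using Finset.card_le_univ T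
  have hL := one_le_entLog hT hTN
  have hLe := Real.add_one_le_exp (entLog N T.card / 4)
  have hs0 : (0 : ℝ) ≤ S.card := by positivity
  constructor
  · have h := hcon.1 S T hST hT
    have he2 : (Real.exp (2 * 1) - 1) / 2 ≤ 4 := by
      rw [two_mul, Real.exp_add]
      nlinarith [Real.exp_one_lt_d9, Real.exp_pos 1]
    have hb := mul_le_mul_of_nonneg_left he2
      (show 0 ≤ D / N * (S.card * T.card : ℝ) by positivity)
    have hw : T.card * entLog N T.card ≤ 4 * entWeight N T.card := by
      unfold entWeight
      nlinarith
    linarith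
  · have h := hcon.2 S T hST hT
    have h2 : 2 * (entLog N T.card / 8) = entLog N T.card / 4 := by ring
    rw [h2] at h
    set l := entLog N T.card with hl
    set x := Real.exp (l / 4) with hx
    have hx0 : 0 < x := Real.exp_pos _
    have hc0 : 0 ≤ D / N * (S.card * T.card : ℝ) * x := by positivity
    have hw : entWeight N T.card = T.card * x := rfl
    rw [hw]
    have hP : 0 ≤ D / N * (S.card * T.card : ℝ) := by positivity
    have h3 : l * eCountC ω S T ≤
        l * (4 * (D / N) * (S.card * (T.card * x)) + 48 * T.card) := by
      nlinarith
    exact le_of_mul_le_mul_left h3 (by linarith)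

/-- The set of coordinates of `z` lying at dyadic level `i`. -/
def levelSet {N : ℕ} (z : Fin N → ℤ) (i : ℕ) : Finset (Fin N) :=
  univ.filter fun u => z u ≠ 0 ∧ dyadicLevel (z u) = i

lemma sum_four_pow_mul_card_levelSet_le {N : ℕ} {z : Fin N → ℤ} (hz : z ∈ gridVecs N) (L : ℕ) :
    ∑ i ∈ Finset.range L, (4 : ℝ) ^ i * (levelSet z i).card ≤ 16 * N := by
  refine le_trans ?_ (mem_gridVecs.1 hz)
  have h : ∀ i, (4 : ℝ) ^ i * (levelSet z i).card =
      ∑ u, if z u ≠ 0 ∧ dyadicLevel (z u) = i then (4 : ℝ) ^ i else 0 := by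
    intro i
    rw [← Finset.sum_filter, Finset.sum_const, nsmul_eq_mul, mul_comm]
    rfl
  simp_rw [h]
  rw [Finset.sum_comm]
  refine Finset.sum_le_sum fun u _ => ?_
  by_cases hu : z u = 0
  · simp [hu]
  · simp only [ne_eq, hu, not_false_eq_true, true_and]
    rw [Finset.sum_ite_eq]
    have h2 := pow_le_pow_left₀ (by positivity) (two_pow_dyadicLevel_le hu) 2
    rw [sq_abs, ← pow_mul, mul_comm, pow_mul] at h2
    split_ifs
    · norm_num at h2 ⊢
      exact h2
    · positivity

lemma sum_eCountC_levelSet_le {N : ℕ} (ω : Config N) (w : Fin N → ℤ) (S : Finset (Fin N)) (L : ℕ)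
    {Δ : ℝ} (hS : ∀ u ∈ S, (degOf ω u : ℝ) ≤ Δ) :
    ∑ j ∈ Finset.range L, eCountC ω S (levelSet w j) ≤ Δ * S.card := by
  simp_rw [eCountC_eq_sum_adjMat]
  rw [Finset.sum_comm]
  have h : ∀ u ∈ S, ∑ j ∈ Finset.range L, ∑ v ∈ levelSet w j, adjMat ω u v ≤ Δ := by
    intro u hu
    refine le_trans ?_ (hS u hu)
    rw [← sum_adjMat_row]
    simp_rw [levelSet, Finset.sum_filter]
    rw [Finset.sum_comm]
    refine Finset.sum_le_sum fun v _ => ?_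
    by_cases hv : w v = 0
    · simp [hv, adjMat_nonneg]
    · simp only [ne_eq, hv, not_false_eq_true, true_and]
      rw [Finset.sum_ite_eq]
      split_ifs
      exacts [le_rfl, adjMat_nonneg ω u v]
  refine (Finset.sum_le_card_nsmul _ _ _ h).trans_eq ?_
  rw [nsmul_eq_mul, mul_comm]

lemma sum_heavy_levelSet_le {N : ℕ} (hN : 1 ≤ N) {D : ℝ} (hD : 0 < D) {ω : Config N}
    (hω : HasDiscrepancy D ω) {z w : Fin N → ℤ} (hz : z ∈ gridVecs N) (hw : w ∈ gridVecs N)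
    (hzdeg : ∀ u, z u ≠ 0 → (degOf ω u : ℝ) ≤ 10 * D) (L : ℕ) :
    ∑ i ∈ Finset.range L, ∑ j ∈ Finset.range L,
      (if ((levelSet z i).card : ℝ) ≤ (levelSet w j).card ∧ √D < 2 ^ (i + j) then
        2 ^ (i + j) * eCountC ω (levelSet z i) (levelSet w j) else 0) ≤ 8096 * √D * N := by
  have hss : √D ^ 2 = D := Real.sq_sqrt hD.le
  refine sum_heavy_levels_le (by exact_mod_cast hN) (Real.sqrt_pos.2 hD) L
    (fun i => (levelSet z i).card) (fun j => (levelSet w j).card)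
    (fun j => entWeight N (levelSet w j).card)
    (fun i j => eCountC ω (levelSet z i) (levelSet w j)) (fun _ => by positivity)
    (fun _ => by positivity) (fun _ _ => eCountC_nonneg _ _ _)
    (sum_four_pow_mul_card_levelSet_le hz L) (sum_four_pow_mul_card_levelSet_le hw L)
    (fun i => ?_) (fun i j hij => ?_) (fun i j hij => ?_) fun j hj => ?_
  · rw [hss]
    exact sum_eCountC_levelSet_le ω w _ L fun u hu => hzdeg u (Finset.mem_filter.1 hu).2.1
  · rw [hss]
    exact (hω _ _ (by exact_mod_cast hij)).1
  · rw [hss]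
    exact (hω _ _ (by exact_mod_cast hij)).2
  · refine two_pow_mul_entWeight_le hN (le_trans ?_ (sum_four_pow_mul_card_levelSet_le hw L))
    exact Finset.single_le_sum (f := fun j => (4 : ℝ) ^ j * (levelSet w j).card)
      (fun _ _ => by positivity) (Finset.mem_range.2 hj)

/-- The heavy couples contribute `O(√D N)` to the adjacency form, on vectors supported on
vertices of bounded degree. -/
lemma sum_heavy_adjMat_le {N : ℕ} (hN : 1 ≤ N) {D : ℝ} (hD : 0 < D) {ω : Config N}
    (hω : HasDiscrepancy D ω) {z w : Fin N → ℤ} (hz : z ∈ gridVecs N) (hw : w ∈ gridVecs N)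
    (hzdeg : ∀ u, z u ≠ 0 → (degOf ω u : ℝ) ≤ 10 * D)
    (hwdeg : ∀ u, w u ≠ 0 → (degOf ω u : ℝ) ≤ 10 * D) :
    ∑ u, ∑ v, (if √D < 2 ^ (dyadicLevel (z u) + dyadicLevel (w v)) then
      |(z u : ℝ)| * |(w v : ℝ)| * adjMat ω u v else 0) ≤ 64768 * √D * N := by
  set L := ∑ u, (dyadicLevel (z u) + dyadicLevel (w u)) + 1 with hL
  have hle : ∀ u, dyadicLevel (z u) + dyadicLevel (w u) < L := fun u =>
    Nat.lt_succ_of_le (Finset.single_le_sum (f := fun u => dyadicLevel (z u) + dyadicLevel (w u))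
      (fun _ _ => Nat.zero_le _) (Finset.mem_univ u))
  set F : ℕ → ℕ → ℝ := fun i j =>
    if √D < 2 ^ (i + j) then 2 ^ (i + j) * eCountC ω (levelSet z i) (levelSet w j) else 0 with hF
  have hlevels : ∑ u, ∑ v, (if √D < 2 ^ (dyadicLevel (z u) + dyadicLevel (w v)) then
      |(z u : ℝ)| * |(w v : ℝ)| * adjMat ω u v else 0) ≤
      4 * ∑ i ∈ Finset.range L, ∑ j ∈ Finset.range L, F i j := by
    have hexp : ∀ i j, F i j = ∑ u, ∑ v,
        if z u ≠ 0 ∧ dyadicLevel (z u) = i then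
          (if w v ≠ 0 ∧ dyadicLevel (w v) = j then
            (if √D < 2 ^ (i + j) then 2 ^ (i + j) * adjMat ω u v else 0) else 0) else 0 := by
      intro i j
      simp only [hF, eCountC_eq_sum_adjMat, levelSet, Finset.sum_filter]
      split_ifs with h
      · rw [Finset.mul_sum]
        refine Finset.sum_congr rfl fun u _ => ?_
        split_ifs
        · rw [Finset.mul_sum]
          refine Finset.sum_congr rfl fun v _ => ?_
          rw [mul_ite, mul_zero]
        · simp
      · simp
    have hswap : ∑ i ∈ Finset.range L, ∑ j ∈ Finset.range L, F i j =
        ∑ u, ∑ v, ∑ i ∈ Finset.range L, ∑ j ∈ Finset.range L,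
        if z u ≠ 0 ∧ dyadicLevel (z u) = i then
          (if w v ≠ 0 ∧ dyadicLevel (w v) = j then
            (if √D < 2 ^ (i + j) then 2 ^ (i + j) * adjMat ω u v else 0) else 0) else 0 := by
      simp_rw [hexp]
      calc _ = ∑ i ∈ Finset.range L, ∑ u, ∑ j ∈ Finset.range L, ∑ v, _ :=
            Finset.sum_congr rfl fun i _ => Finset.sum_comm
        _ = ∑ u, ∑ i ∈ Finset.range L, ∑ j ∈ Finset.range L, ∑ v, _ := Finset.sum_comm
        _ = ∑ u, ∑ i ∈ Finset.range L, ∑ v, ∑ j ∈ Finset.range L, _ :=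
            Finset.sum_congr rfl fun u _ => Finset.sum_congr rfl fun i _ => Finset.sum_comm
        _ = _ := Finset.sum_congr rfl fun u _ => Finset.sum_comm
    rw [hswap, Finset.mul_sum]
    refine Finset.sum_le_sum fun u _ => ?_
    rw [Finset.mul_sum]
    refine Finset.sum_le_sum fun v _ => ?_
    have hAuv := adjMat_nonneg ω u v
    by_cases hu : z u = 0
    · simp [hu]
    by_cases hv : w v = 0
    · simp [hv]
    have hcollapse : (∑ i ∈ Finset.range L, ∑ j ∈ Finset.range L,
        if z u ≠ 0 ∧ dyadicLevel (z u) = i then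
          (if w v ≠ 0 ∧ dyadicLevel (w v) = j then
            (if √D < 2 ^ (i + j) then 2 ^ (i + j) * adjMat ω u v else 0) else 0) else 0) =
        if √D < 2 ^ (dyadicLevel (z u) + dyadicLevel (w v)) then
          2 ^ (dyadicLevel (z u) + dyadicLevel (w v)) * adjMat ω u v else 0 := by
      rw [Finset.sum_eq_single (dyadicLevel (z u)), Finset.sum_eq_single (dyadicLevel (w v))]
      · simp [hu, hv]
      · intro j _ hj
        simp [hj.symm]
      · intro h
        exact absurd (Finset.mem_range.2 (by have := hle v; omega)) h
      · intro i _ hi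
        simp [hi.symm]
      · intro h
        exact absurd (Finset.mem_range.2 (by have := hle u; omega)) h
    rw [hcollapse]
    split_ifs
    · have := mul_le_mul (abs_le_two_pow_dyadicLevel (z u)) (abs_le_two_pow_dyadicLevel (w v))
        (abs_nonneg _) (by positivity)
      calc |(z u : ℝ)| * |(w v : ℝ)| * adjMat ω u v
          ≤ 2 * 2 ^ dyadicLevel (z u) * (2 * 2 ^ dyadicLevel (w v)) * adjMat ω u v :=
            mul_le_mul_of_nonneg_right this hAuv
        _ = _ := by rw [pow_add]; ring
    · simp
  have hsplit : ∑ i ∈ Finset.range L, ∑ j ∈ Finset.range L, F i j ≤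
      ∑ i ∈ Finset.range L, ∑ j ∈ Finset.range L,
      (if ((levelSet z i).card : ℝ) ≤ (levelSet w j).card ∧ √D < 2 ^ (i + j) then
        2 ^ (i + j) * eCountC ω (levelSet z i) (levelSet w j) else 0) +
      ∑ j ∈ Finset.range L, ∑ i ∈ Finset.range L,
      (if ((levelSet w j).card : ℝ) ≤ (levelSet z i).card ∧ √D < 2 ^ (j + i) then
        2 ^ (j + i) * eCountC ω (levelSet w j) (levelSet z i) else 0) := by
    rw [Finset.sum_comm (s := Finset.range L) (t := Finset.range L) (f := fun j i =>
      (if ((levelSet w j).card : ℝ) ≤ (levelSet z i).card ∧ √D < 2 ^ (j + i) then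
        2 ^ (j + i) * eCountC ω (levelSet w j) (levelSet z i) else 0)), ← Finset.sum_add_distrib]
    refine Finset.sum_le_sum fun i _ => ?_
    rw [← Finset.sum_add_distrib]
    refine Finset.sum_le_sum fun j _ => ?_
    rw [add_comm j i, eCountC_comm ω (levelSet w j)]
    have hnn : 0 ≤ 2 ^ (i + j) * eCountC ω (levelSet z i) (levelSet w j) :=
      mul_nonneg (by positivity) (eCountC_nonneg _ _ _)
    simp only [hF]
    by_cases hh : √D < 2 ^ (i + j)
    · simp only [hh, and_true, if_true]
      rcases le_total ((levelSet z i).card : ℝ) (levelSet w j).card with h | h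
      · rw [if_pos h]
        split_ifs <;> linarith
      · rw [if_pos h]
        split_ifs <;> linarith
    · simp [hh]
  have h1 := sum_heavy_levelSet_le hN hD hω hz hw hzdeg L
  have h2 := sum_heavy_levelSet_le hN hD hω hw hz hwdeg L
  linarith

lemma sum_heavy_expectation_le {N : ℕ} (hN : 1 ≤ N) {p : Fin N → Fin N → ℝ} {D : ℝ}
    (hD : 0 < D) (hδ : ∀ i j, p i j ≤ D / N)
    {z w : Fin N → ℤ} (hz : z ∈ gridVecs N) (hw : w ∈ gridVecs N) :
    ∑ u, ∑ v, (if √D < 2 ^ (dyadicLevel (z u) + dyadicLevel (w v)) then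
      |(z u : ℝ)| * |(w v : ℝ)| * p u v else 0) ≤ 256 * √D * N := by
  have hN0 : (0 : ℝ) < N := by exact_mod_cast hN
  have hs : 0 < √D := Real.sqrt_pos.2 hD
  have hss : √D * √D = D := Real.mul_self_sqrt hD.le
  have key : ∀ u v, (if √D < 2 ^ (dyadicLevel (z u) + dyadicLevel (w v)) then
      |(z u : ℝ)| * |(w v : ℝ)| * p u v else 0) ≤
      √D / N * ((z u : ℝ) ^ 2 * (w v : ℝ) ^ 2) := by
    intro u v
    split_ifs with h
    swap
    · positivity
    rcases eq_or_ne (z u) 0 with hzu | hzu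
    · simp [hzu]
    rcases eq_or_ne (w v) 0 with hwv | hwv
    · simp [hwv]
    have h1 := two_pow_dyadicLevel_le hzu
    have h2 := two_pow_dyadicLevel_le hwv
    set P := |(z u : ℝ)| * |(w v : ℝ)| with hP
    have hP0 : 0 ≤ P := by positivity
    have h3 : √D ≤ P := by
      rw [pow_add] at h
      exact h.le.trans (mul_le_mul h1 h2 (by positivity) (abs_nonneg _))
    have h4 : (z u : ℝ) ^ 2 * (w v : ℝ) ^ 2 = P * P := by
      rw [hP, ← sq_abs (z u : ℝ), ← sq_abs (w v : ℝ)]; ring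
    rw [h4]
    calc P * p u v ≤ P * (D / N) := mul_le_mul_of_nonneg_left (hδ u v) hP0
      _ = √D / N * (√D * P) := by
        rw [show D / N = √D * √D / N by rw [hss]]; ring
      _ ≤ √D / N * (P * P) := by gcongr
  calc _ ≤ ∑ u, ∑ v, √D / N * ((z u : ℝ) ^ 2 * (w v : ℝ) ^ 2) :=
        Finset.sum_le_sum fun u _ => Finset.sum_le_sum fun v _ => key u v
    _ = √D / N * ∑ u, ∑ v, (z u : ℝ) ^ 2 * (w v : ℝ) ^ 2 := by
        simp only [Finset.mul_sum]
    _ ≤ √D / N * (256 * N ^ 2) :=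
        mul_le_mul_of_nonneg_left (sum_sq_mul_sq_le hz hw) (by positivity)
    _ = 256 * √D * N := by field_simp

lemma sum_mul_adjMat_sub_le {N : ℕ} (hN : 1 ≤ N) {p : Fin N → Fin N → ℝ} {D : ℝ}
    (hD : 0 < D) (h0 : ∀ i j, 0 ≤ p i j) (hδ : ∀ i j, p i j ≤ D / N) {ω : Config N}
    (hdisc : HasDiscrepancy D ω) {z w : Fin N → ℤ} (hz : z ∈ gridVecs N) (hw : w ∈ gridVecs N)
    (hlight : ∑ u, ∑ v, lightCoef D z w u v * (adjMat ω u v - p u v) ≤ 360 * √D * N)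
    (hzdeg : ∀ u, z u ≠ 0 → (degOf ω u : ℝ) ≤ 10 * D)
    (hwdeg : ∀ u, w u ≠ 0 → (degOf ω u : ℝ) ≤ 10 * D) :
    ∑ u, ∑ v, (z u : ℝ) * w v * (adjMat ω u v - p u v) ≤ 65384 * √D * N := by
  have h1 := sum_heavy_adjMat_le hN hD hdisc hz hw hzdeg hwdeg
  have h2 := sum_heavy_expectation_le hN hD hδ hz hw
  have key : ∑ u, ∑ v, (z u : ℝ) * w v * (adjMat ω u v - p u v) ≤
      ∑ u, ∑ v, lightCoef D z w u v * (adjMat ω u v - p u v) +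
      ∑ u, ∑ v, (if √D < 2 ^ (dyadicLevel (z u) + dyadicLevel (w v)) then
        |(z u : ℝ)| * |(w v : ℝ)| * adjMat ω u v else 0) +
      ∑ u, ∑ v, (if √D < 2 ^ (dyadicLevel (z u) + dyadicLevel (w v)) then
        |(z u : ℝ)| * |(w v : ℝ)| * p u v else 0) := by
    simp only [← Finset.sum_add_distrib]
    refine Finset.sum_le_sum fun u _ => Finset.sum_le_sum fun v _ => ?_
    unfold lightCoef
    rcases le_or_gt ((2 : ℝ) ^ (dyadicLevel (z u) + dyadicLevel (w v))) (√D) with h | h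
    · rw [if_pos h, if_neg h.not_gt, if_neg h.not_gt]; simp
    · rw [if_neg h.not_ge, if_pos h, if_pos h, ← abs_mul, zero_mul, zero_add, ← mul_add]
      have ha := adjMat_nonneg ω u v
      have hb := h0 u v
      calc (z u : ℝ) * w v * (adjMat ω u v - p u v)
          ≤ |(z u : ℝ) * w v * (adjMat ω u v - p u v)| := le_abs_self _
        _ = |(z u : ℝ) * w v| * |adjMat ω u v - p u v| := abs_mul _ _
        _ ≤ |(z u : ℝ) * w v| * (adjMat ω u v + p u v) :=
          mul_le_mul_of_nonneg_left (abs_le.2 ⟨by linarith, by linarith⟩) (abs_nonneg _)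
  linarith

lemma sum_mul_zeroOutHighDeg_le {N : ℕ} (hN : 1 ≤ N) {p : Fin N → Fin N → ℝ} {D d : ℝ}
    (hD : 0 < D) (hdD : 20 * d = 10 * D) (h0 : ∀ i j, 0 ≤ p i j) (hδ : ∀ i j, p i j ≤ D / N)
    {ω : Config N} (hdisc : HasDiscrepancy D ω)
    (hlight : ∀ z ∈ gridVecs N, ∀ w ∈ gridVecs N,
      ∑ u, ∑ v, lightCoef D z w u v * (adjMat ω u v - p u v) ≤ 360 * √D * N)
    {z w : Fin N → ℤ} (hz : z ∈ gridVecs N) (hw : w ∈ gridVecs N) :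
    ∑ u, ∑ v, (z u : ℝ) * w v * zeroOutHighDeg d ω (fun i j => adjMat ω i j - p i j) u v ≤
      65384 * √D * N := by
  have trunc : ∀ x ∈ gridVecs N,
      (fun u => if 20 * d < (degOf ω u : ℝ) then 0 else x u) ∈ gridVecs N := by
    intro x hx
    rw [mem_gridVecs] at hx ⊢
    refine le_trans (Finset.sum_le_sum fun i _ => ?_) hx
    split_ifs
    · simpa using sq_nonneg _
    · exact le_rfl
  have hdeg : ∀ (x : Fin N → ℤ) (u : Fin N),
      (if 20 * d < (degOf ω u : ℝ) then 0 else x u) ≠ 0 → (degOf ω u : ℝ) ≤ 10 * D := by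
    intro x u h
    by_contra hcon
    exact h (if_pos (by rw [hdD]; exact not_le.1 hcon))
  refine le_trans (le_of_eq ?_) (sum_mul_adjMat_sub_le hN hD h0 hδ hdisc (trunc z hz) (trunc w hw)
    (hlight _ (trunc z hz) _ (trunc w hw)) (hdeg z) (hdeg w))
  refine Finset.sum_congr rfl fun u _ => Finset.sum_congr rfl fun v _ => ?_
  unfold zeroOutHighDeg
  by_cases h1 : 20 * d < (degOf ω u : ℝ) <;> by_cases h2 : 20 * d < (degOf ω v : ℝ) <;>
    simp [h1, h2]

lemma exists_gridVec_near {N : ℕ} (hN : 1 ≤ N) {x : EuclideanSpace ℝ (Fin N)} (hx : ‖x‖ = 1) :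
    ∃ z ∈ gridVecs N, ‖x - WithLp.toLp 2 fun u => (z u : ℝ) / (2 * √N)‖ ≤ 1 / 4 := by
  have hN0 : (0 : ℝ) < N := by exact_mod_cast hN
  have hs : 0 < √(N : ℝ) := Real.sqrt_pos.2 hN0
  have hsq : √(N : ℝ) ^ 2 = N := Real.sq_sqrt hN0.le
  have hsum : ∑ u, x u ^ 2 = 1 := by
    have := EuclideanSpace.real_norm_sq_eq x
    rw [hx] at this
    linarith
  refine ⟨fun u => round (2 * √N * x u), ?_, ?_⟩
  · rw [mem_gridVecs]
    have hle : ∀ u, ((round (2 * √N * x u) : ℤ) : ℝ) ^ 2 ≤ 16 * N * x u ^ 2 := by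
      intro u
      set v := 2 * √N * x u with hv
      have hvv : 16 * N * x u ^ 2 = (2 * |v|) ^ 2 := by
        rw [mul_pow, sq_abs, hv]; linear_combination (-16 * x u ^ 2) * hsq
      rw [hvv, ← sq_abs]
      refine pow_le_pow_left₀ (abs_nonneg _) ?_ 2
      rcases eq_or_ne (round v) 0 with h0 | h0
      · simp [h0]
      have h1 : (1 : ℝ) ≤ |((round v : ℤ) : ℝ)| := by
        exact_mod_cast Int.one_le_abs h0
      have h2 := abs_sub_round v
      have h3 := abs_sub_abs_le_abs_sub ((round v : ℤ) : ℝ) v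
      rw [abs_sub_comm] at h3
      linarith
    calc ∑ u, ((round (2 * √N * x u) : ℤ) : ℝ) ^ 2 ≤ ∑ u, 16 * N * x u ^ 2 :=
          Finset.sum_le_sum fun u _ => hle u
      _ = 16 * N := by rw [← Finset.mul_sum, hsum, mul_one]
  · refine abs_le_of_sq_le_sq' ?_ (by norm_num) |>.2
    rw [EuclideanSpace.real_norm_sq_eq]
    calc _ ≤ ∑ _u : Fin N, 1 / (16 * (N : ℝ)) := by
          refine Finset.sum_le_sum fun u _ => ?_
          have h2 := abs_sub_round (2 * √N * x u)
          have h3 : (2 * √N * x u - (round (2 * √N * x u) : ℤ)) ^ 2 ≤ (1 / 2) ^ 2 :=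
            sq_le_sq' (by linarith [(abs_le.1 h2).1]) (abs_le.1 h2).2
          have h4 : x u - (round (2 * √N * x u) : ℤ) / (2 * √N) =
              (2 * √N * x u - (round (2 * √N * x u) : ℤ)) / (2 * √N) := by
            field_simp
          simp only [PiLp.sub_apply]
          rw [h4, div_pow, mul_pow, hsq, div_le_div_iff₀ (by positivity) (by positivity)]
          nlinarith
      _ = (1 / 4) ^ 2 := by
          rw [Finset.sum_const, Finset.card_univ, Fintype.card_fin, nsmul_eq_mul]
          field_simp
          norm_num

lemma opNorm_le_of_gridVecs {N : ℕ} (hN : 1 ≤ N) {M : Matrix (Fin N) (Fin N) ℝ} {B : ℝ}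
    (hM : ∀ z ∈ gridVecs N, ∀ w ∈ gridVecs N, ∑ u, ∑ v, (z u : ℝ) * w v * M u v ≤ B * N) :
    opNorm M ≤ 4 / 7 * B := by
  have hN0 : (0 : ℝ) < N := by exact_mod_cast hN
  have hsq : √(N : ℝ) ^ 2 = N := Real.sq_sqrt hN0.le
  have hB : 0 ≤ B := by
    have h0 : (0 : Fin N → ℤ) ∈ gridVecs N := by rw [mem_gridVecs]; simp
    have := hM 0 h0 0 h0
    simp only [Pi.zero_apply, Int.cast_zero, zero_mul, Finset.sum_const_zero] at this
    exact nonneg_of_mul_nonneg_left this hN0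
  unfold opNorm
  set T := LinearMap.toContinuousLinearMap (Matrix.toEuclideanLin M) with hT
  have hbil : ∀ z ∈ gridVecs N, ∀ w ∈ gridVecs N,
      inner ℝ (WithLp.toLp 2 fun u => (z u : ℝ) / (2 * √N) : EuclideanSpace ℝ (Fin N))
        (T (WithLp.toLp 2 fun u => (w u : ℝ) / (2 * √N))) ≤ B / 4 := by
    intro z hz w hw
    have h := hM z hz w hw
    have heq : inner ℝ (WithLp.toLp 2 fun u => (z u : ℝ) / (2 * √N) : EuclideanSpace ℝ (Fin N))
        (T (WithLp.toLp 2 fun u => (w u : ℝ) / (2 * √N))) =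
        1 / (4 * N) * ∑ u, ∑ v, (z u : ℝ) * w v * M u v := by
      simp only [hT, LinearMap.coe_toContinuousLinearMap', PiLp.inner_apply,
        Matrix.toLpLin_apply, Matrix.mulVec, dotProduct, Finset.mul_sum,
        RCLike.inner_apply, conj_trivial, Finset.sum_mul]
      refine Finset.sum_congr rfl fun u _ => Finset.sum_congr rfl fun v _ => ?_
      rw [show (4 : ℝ) * N = (2 * √N) * (2 * √N) by
        linear_combination (-4) * hsq]
      field_simp
    rw [heq]
    calc _ ≤ 1 / (4 * (N : ℝ)) * (B * N) := mul_le_mul_of_nonneg_left h (by positivity)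
      _ = B / 4 := by field_simp
  have hmain : ‖T‖ ≤ B / 4 + 9 / 16 * ‖T‖ := by
    refine ContinuousLinearMap.opNorm_le_of_unit_norm (by positivity) fun x hx => ?_
    rcases eq_or_ne (T x) 0 with h0 | h0
    · rw [h0, norm_zero]; positivity
    set y := (‖T x‖)⁻¹ • T x with hy
    have hTx : 0 < ‖T x‖ := norm_pos_iff.2 h0
    have hyn : ‖y‖ = 1 := by
      rw [hy, norm_smul, norm_inv, norm_norm, inv_mul_cancel₀ hTx.ne']
    have hyT : inner ℝ y (T x) = ‖T x‖ := by
      rw [hy, real_inner_smul_left, real_inner_self_eq_norm_sq]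
      field_simp
    obtain ⟨z, hz, hzy⟩ := exists_gridVec_near hN hyn
    obtain ⟨w, hw, hwx⟩ := exists_gridVec_near hN hx
    have hb := hbil z hz w hw
    set y' : EuclideanSpace ℝ (Fin N) := WithLp.toLp 2 fun u => (z u : ℝ) / (2 * √N)
    set x' : EuclideanSpace ℝ (Fin N) := WithLp.toLp 2 fun u => (w u : ℝ) / (2 * √N)
    have hx' : ‖x'‖ ≤ 5 / 4 := by
      have : ‖x'‖ ≤ ‖x‖ + ‖x - x'‖ := by
        simpa using norm_sub_le x (x - x')
      linarith
    have hsplit : inner ℝ y (T x) =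
        inner ℝ y' (T x') + inner ℝ (y - y') (T x') + inner ℝ y (T (x - x')) := by
      rw [map_sub, inner_sub_left, inner_sub_right]; ring
    have h1 : inner ℝ (y - y') (T x') ≤ 1 / 4 * (‖T‖ * (5 / 4)) :=
      (real_inner_le_norm _ _).trans (mul_le_mul hzy
        ((T.le_opNorm x').trans (by gcongr)) (norm_nonneg _) (by norm_num))
    have h2 : inner ℝ y (T (x - x')) ≤ 1 * (‖T‖ * (1 / 4)) :=
      (real_inner_le_norm _ _).trans (mul_le_mul hyn.le
        ((T.le_opNorm _).trans (by gcongr)) (norm_nonneg _) (by norm_num))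
    linarith
  linarith

lemma measureReal_not_opNorm_le {N : ℕ} (hN : 1 ≤ N) {p : Fin N → Fin N → ℝ} {d : ℝ}
    (hd : 0 < d) (h0 : ∀ i j, 0 ≤ p i j) (h1 : ∀ i j, p i j ≤ 1) (hδ : ∀ i j, p i j ≤ 2 * d / N)
    (hsymm : ∀ i j, p i j = p j i) (hdiag : ∀ i, p i i = 0) :
    (genMeasure p).real {ω | ¬ opNorm (zeroOutHighDeg d ω fun i j => adjMat ω i j - p i j) ≤
      65384 * √d} ≤ Real.exp (-N) + 2 / N := by
  have hD : 0 < 2 * d := by positivity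
  refine le_trans ?_ (add_le_add (measureReal_not_light_le hN hD h0 h1 hδ hsymm hdiag)
    (measureReal_not_hasDiscrepancy_le hN hD h0 h1 hδ))
  refine (measureReal_mono (fun ω hω => ?_) (measure_ne_top _ _)).trans (measureReal_union_le _ _)
  by_contra hcon
  simp only [Set.mem_union, Set.mem_ofPred_eq, not_or, not_not] at hcon
  refine hω ((opNorm_le_of_gridVecs hN fun z hz w hw =>
    sum_mul_zeroOutHighDeg_le hN hD (by ring) h0 hδ hcon.2 hcon.1 hz hw).trans ?_)
  have h2 : √(2 * d) ≤ 3 / 2 * √d := by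
    rw [Real.sqrt_mul (by norm_num)]
    exact mul_le_mul_of_nonneg_right
      (Real.sqrt_le_iff.2 ⟨by norm_num, by norm_num⟩) (Real.sqrt_nonneg d)
  linarith [Real.sqrt_nonneg d]

lemma sbm2_eq_genMeasure (n : ℕ) (a b : ℝ) : sbm2 n a b = genMeasure (expAdj n a b) := by
  unfold sbm2 genMeasure expAdj
  congr 1
  funext e
  rw [if_neg e.2.ne]

lemma measureReal_sbm2_not_opNorm_le {n : ℕ} (hn : 1 ≤ n) {a b : ℝ} (hb : 0 < b) (hab : b < a)
    (han : a ≤ n) :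
    (sbm2 n a b).real {ω | ¬ opNorm (zeroOutHighDeg (a + b) ω (adjMat ω - expAdj n a b)) ≤
      65384 * √(a + b)} ≤ Real.exp (-n) + 1 / n := by
  have hn0 : (0 : ℝ) < n := by exact_mod_cast hn
  have ha : 0 < a := hb.trans hab
  rw [sbm2_eq_genMeasure]
  have hp : ∀ i j, 0 ≤ expAdj n a b i j ∧ expAdj n a b i j ≤ a / n := by
    intro i j
    have h1 : 0 ≤ a / n := by positivity
    have h2 : 0 ≤ b / n := by positivity
    have h3 : b / n ≤ a / n := by gcongr
    unfold expAdj
    split_ifs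
    · exact ⟨le_rfl, h1⟩
    · exact ⟨h1, le_rfl⟩
    · exact ⟨h2, h3⟩
  have h := measureReal_not_opNorm_le (N := 2 * n) (p := expAdj n a b) (d := a + b) (by lia)
    (by positivity) (fun i j => (hp i j).1)
    (fun i j => (hp i j).2.trans ((div_le_one hn0).2 han))
    (fun i j => (hp i j).2.trans (by
      push_cast
      rw [mul_div_mul_left _ _ two_ne_zero]
      gcongr
      linarith))
    (fun i j => by simp only [expAdj, eq_comm (a := i), iff_comm (a := (i : ℕ) < n)])
    (fun i => by simp [expAdj])
  refine h.trans ?_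
  push_cast
  refine add_le_add (Real.exp_le_exp.2 (by linarith)) (le_of_eq ?_)
  field_simp

/-- Corollary 3.4 / `lem:normE`: in `SBM(n,a,b)` with
`a > b ≥ C₀`, the matrix `E` obtained from `E₀ = A₀ - Ā₀` by zeroing out the rows and
columns of the vertices of degree `> 20 d` (`d := a + b`) satisfies `‖E‖ ≤ C √d` with
probability `1 - o(1)`. -/
theorem sbm_noise_norm_bound :
    ∃ C₀ C : ℝ, 0 < C ∧ ∀ a b : ℝ, C₀ ≤ b → b < a →
      Tendsto
        (fun n => sbm2 n a b
          {ω | opNorm (zeroOutHighDeg (a + b) ω (adjMat ω - expAdj n a b)) ≤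
            C * Real.sqrt (a + b)})
        atTop (nhds 1) := by
  refine ⟨1, 65384, by norm_num, fun a b hb hab => ?_⟩
  have hprob : ∀ n, IsProbabilityMeasure (sbm2 n a b) := fun n => by
    unfold sbm2; infer_instance
  set good : (n : ℕ) → Set (Config (2 * n)) := fun n =>
    {ω | opNorm (zeroOutHighDeg (a + b) ω (adjMat ω - expAdj n a b)) ≤
      65384 * Real.sqrt (a + b)} with hgood
  have hreal : Tendsto (fun n => (sbm2 n a b).real (good n)) atTop (nhds 1) := by
    have hlim : Tendsto (fun n : ℕ => 1 - (Real.exp (-n) + 1 / n)) atTop (nhds 1) := by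
      have h1 : Tendsto (fun n : ℕ => Real.exp (-(n : ℝ))) atTop (nhds 0) :=
        Real.tendsto_exp_neg_atTop_nhds_zero.comp tendsto_natCast_atTop_atTop
      simpa using (h1.add tendsto_one_div_atTop_nhds_zero_nat).const_sub 1
    refine tendsto_of_tendsto_of_tendsto_of_le_of_le' hlim tendsto_const_nhds ?_
      (Eventually.of_forall fun n => measureReal_le_one)
    filter_upwards [eventually_ge_atTop (max 1 ⌈a⌉₊)] with n hn
    have h := measureReal_sbm2_not_opNorm_le (n := n) ((le_max_left _ _).trans hn)
      (by linarith) hab (Nat.ceil_le.1 ((le_max_right _ _).trans hn))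
    have hc := probReal_compl_eq_one_sub (μ := sbm2 n a b)
      (MeasurableSet.of_discrete (s := good n))
    have heq : (good n)ᶜ = {ω | ¬ opNorm (zeroOutHighDeg (a + b) ω
      (adjMat ω - expAdj n a b)) ≤ 65384 * √(a + b)} := rfl
    rw [heq] at hc
    linarith
  have := ENNReal.tendsto_ofReal hreal
  simpa [ofReal_measureReal] using this
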